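/- arXiv:2409.15880 — 2 statements merged into one kernel-verified Lean document; each statement's English description precedes it below -/
import Mathlib

section
/- Let S = {1, R6, R6⁻¹, R6⁻², R3, R3², R3R6⁻¹, R3²R6⁻¹} ⊆ Γ⁺ (with R6 = βα, R3 = γβ) and S' = {αgβ : g ∈ S}, which is also a subset of Γ⁺. Then the two-tile tileset {S, S'} tiles Γ⁺ and is mildly aperiodic: there exists a cotiler C ⊆ Γ⁺ × {S, S'} (meaning the sets c·T for (c,T) ∈ C partition Γ⁺), every such cotiler has finite stabilizer, and S and S' are not left translates of each other in Γ⁺. -/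
open scoped Pointwise

/-- The Coxeter relations of the symmetry group of the Kitegrid:
`α², β², γ², (αβ)⁶, (βγ)³, (αγ)²`. -/
def kitegridRels : Set (FreeGroup (Fin 3)) :=
  {(FreeGroup.of 0) ^ 2, (FreeGroup.of 1) ^ 2, (FreeGroup.of 2) ^ 2,
   (FreeGroup.of 0 * FreeGroup.of 1) ^ 6, (FreeGroup.of 1 * FreeGroup.of 2) ^ 3,
   (FreeGroup.of 0 * FreeGroup.of 2) ^ 2}

/-- `Γ = ⟨α, β, γ | α², β², γ², (αβ)⁶, (βγ)³, (αγ)²⟩`. -/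
abbrev KitegridGroup := PresentedGroup kitegridRels

namespace KitegridGroup

def α : KitegridGroup := PresentedGroup.of 0
def β : KitegridGroup := PresentedGroup.of 1
def γ : KitegridGroup := PresentedGroup.of 2

/-- `R6 = βα`. -/
def R6 : KitegridGroup := β * α
/-- `R3 = γβ`. -/
def R3 : KitegridGroup := γ * β

/-- `Γ⁺`, the index-2 subgroup of elements of even word length, generated by `R6` and `R3`. -/
def Γplus : Subgroup KitegridGroup := Subgroup.closure {R6, R3}

/-- The 8-element discretization `S` of the Hat in `Γ⁺`. -/
def hatPlus : Set KitegridGroup :=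
  {1, R6, R6⁻¹, R6⁻¹ * R6⁻¹, R3, R3 * R3, R3 * R6⁻¹, R3 * R3 * R6⁻¹}

/-- The reflected tile `S' = {α g β : g ∈ S}`. -/
def hatPlusRefl : Set KitegridGroup := (fun g => α * g * β) '' hatPlus

/-- `C ⊆ Γ⁺ × {S, S'}` is a cotiler of the two-tile tileset `{S, S'}` in `Γ⁺`:
the translates `c • T`, `(c,T) ∈ C`, partition the subset `Γ⁺` of `Γ`. -/
def IsCotiler2 (C : Set (KitegridGroup × Set KitegridGroup)) : Prop :=
  C ⊆ (Γplus : Set KitegridGroup) ×ˢ {hatPlus, hatPlusRefl} ∧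
  (∀ p ∈ C, ∀ q ∈ C, p ≠ q → Disjoint (p.1 • p.2) (q.1 • q.2)) ∧
  (⋃ p ∈ C, p.1 • p.2) = (Γplus : Set KitegridGroup)

end KitegridGroup

open KitegridGroup

/-- Abelian groups with an action of `ZMod 6`, thought of as rotations by multiples of `π / 3`. -/
class HexModule (V : Type*) [AddCommGroup V] where
  /-- Rotation by `k * π / 3`. -/
  rot : ZMod 6 → V → V
  rot_zero : ∀ v, rot 0 v = v
  rot_rot : ∀ k l v, rot k (rot l v) = rot (k + l) v
  rot_add : ∀ k v w, rot k (v + w) = rot k v + rot k w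

namespace HexModule

variable {V : Type*} [AddCommGroup V] [HexModule V]

/-- Rotation as an additive homomorphism. -/
def rotHom (k : ZMod 6) : V →+ V := AddMonoidHom.mk' (rot k) (rot_add k)

theorem rot_of_zero (k : ZMod 6) : rot k (0 : V) = 0 := (rotHom k).map_zero
theorem rot_neg (k : ZMod 6) (v : V) : rot k (-v) = -rot k v := (rotHom k).map_neg v
theorem rot_sub (k : ZMod 6) (v w : V) : rot k (v - w) = rot k v - rot k w :=
  (rotHom k).map_sub v w

theorem rot_cancel (k : ZMod 6) (v : V) : rot k (rot (-k) v) = v := by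
  rw [rot_rot, add_neg_cancel, rot_zero]

/-- Rotations of the Eisenstein lattice with basis `1, ω`, where `ω ^ 2 = ω - 1`. -/
def rotInt (k : ZMod 6) (v : ℤ × ℤ) : ℤ × ℤ :=
  match k.val with
  | 0 => v
  | 1 => (-v.2, v.1 + v.2)
  | 2 => (-v.1 - v.2, v.1)
  | 3 => (-v.1, -v.2)
  | 4 => (v.2, -v.1 - v.2)
  | _ => (v.1 + v.2, -v.1)

@[simp] theorem rotInt_zero (v : ℤ × ℤ) : rotInt 0 v = v := rfl
@[simp] theorem rotInt_one (v : ℤ × ℤ) : rotInt 1 v = (-v.2, v.1 + v.2) := rfl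
@[simp] theorem rotInt_two (v : ℤ × ℤ) : rotInt 2 v = (-v.1 - v.2, v.1) := rfl
@[simp] theorem rotInt_three (v : ℤ × ℤ) : rotInt 3 v = (-v.1, -v.2) := rfl
@[simp] theorem rotInt_four (v : ℤ × ℤ) : rotInt 4 v = (v.2, -v.1 - v.2) := rfl
@[simp] theorem rotInt_five (v : ℤ × ℤ) : rotInt 5 v = (v.1 + v.2, -v.1) := rfl

theorem forall_zmod6 {p : ZMod 6 → Prop} :
    (∀ k, p k) ↔ p 0 ∧ p 1 ∧ p 2 ∧ p 3 ∧ p 4 ∧ p 5 := by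
  constructor
  · intro h; exact ⟨h 0, h 1, h 2, h 3, h 4, h 5⟩
  · rintro ⟨h0, h1, h2, h3, h4, h5⟩ k
    fin_cases k <;> assumption

theorem rotInt_add_one (k : ZMod 6) (v : ℤ × ℤ) : rotInt (k + 1) v = rotInt 1 (rotInt k v) := by
  revert k
  rw [forall_zmod6]
  refine ⟨?_, ?_, ?_, ?_, ?_, ?_⟩ <;> ext <;> simp [show (1 : ZMod 6) + 1 = 2 from rfl,
    show (2 : ZMod 6) + 1 = 3 from rfl, show (3 : ZMod 6) + 1 = 4 from rfl,
    show (4 : ZMod 6) + 1 = 5 from rfl, show (5 : ZMod 6) + 1 = 0 from rfl] <;> ring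

theorem rotInt_natCast_add (n : ℕ) (l : ZMod 6) (v : ℤ × ℤ) :
    rotInt (n + l) v = rotInt n (rotInt l v) := by
  induction n with
  | zero => simp
  | succ n ih =>
    rw [Nat.cast_succ, rotInt_add_one, ← ih, ← rotInt_add_one, add_right_comm]

instance {V W : Type*} [AddCommGroup V] [HexModule V] [AddCommGroup W] [HexModule W] :
    HexModule (V × W) where
  rot k v := (rot k v.1, rot k v.2)
  rot_zero v := by simp [rot_zero]
  rot_rot k l v := by simp [rot_rot]
  rot_add k v w := by simp [rot_add]

instance : HexModule (ℤ × ℤ) where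
  rot := rotInt
  rot_zero _ := rfl
  rot_rot k l v := by
    have := rotInt_natCast_add k.val l v
    rw [ZMod.natCast_zmod_val] at this
    exact this.symm
  rot_add k v w := by
    revert k
    rw [forall_zmod6]
    refine ⟨?_, ?_, ?_, ?_, ?_, ?_⟩ <;> ext <;> simp <;> ring

@[simp] theorem rot_eq_rotInt (k : ZMod 6) (v : ℤ × ℤ) : rot k v = rotInt k v := rfl

end HexModule

open HexModule (rot)

/-- A frame `(pos, dir)` stands for the motion `z ↦ pos + rot dir z`. -/
@[ext] structure Frame (V : Type*) where
  pos : V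
  dir : ZMod 6

namespace Frame

variable {V : Type*} [AddCommGroup V] [HexModule V]

instance [DecidableEq V] : DecidableEq (Frame V) := fun x y =>
  decidable_of_iff (x.pos = y.pos ∧ x.dir = y.dir) Frame.ext_iff.symm

instance : Mul (Frame V) := ⟨fun x y => ⟨x.pos + rot x.dir y.pos, x.dir + y.dir⟩⟩
instance : One (Frame V) := ⟨⟨0, 0⟩⟩
instance : Inv (Frame V) := ⟨fun x => ⟨-rot (-x.dir) x.pos, -x.dir⟩⟩

@[simp] theorem mul_pos (x y : Frame V) : (x * y).pos = x.pos + rot x.dir y.pos := rfl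
@[simp] theorem mul_dir (x y : Frame V) : (x * y).dir = x.dir + y.dir := rfl
@[simp] theorem one_pos {V : Type*} [AddCommGroup V] : (1 : Frame V).pos = 0 := rfl
@[simp] theorem one_dir {V : Type*} [AddCommGroup V] : (1 : Frame V).dir = 0 := rfl
@[simp] theorem inv_pos (x : Frame V) : x⁻¹.pos = -rot (-x.dir) x.pos := rfl
@[simp] theorem inv_dir (x : Frame V) : x⁻¹.dir = -x.dir := rfl

instance : Group (Frame V) := Group.ofLeftAxioms
  (fun x y z => by ext <;> simp [HexModule.rot_add, HexModule.rot_rot, add_assoc])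
  (fun x => by ext <;> simp [HexModule.rot_zero])
  (fun x => by ext <;> simp)

end Frame

/-- Kites of the Kitegrid, indexed by `Γ⁺`. -/
abbrev Kite := Frame (ℤ × ℤ)

namespace KitegridGroup

theorem α_mul_self : α * α = 1 := by
  have : (PresentedGroup.mk kitegridRels) ((FreeGroup.of 0) ^ 2) = 1 :=
    PresentedGroup.one_of_mem (by simp [kitegridRels])
  rw [map_pow, pow_two] at this
  exact this

theorem β_mul_self : β * β = 1 := by
  have : (PresentedGroup.mk kitegridRels) ((FreeGroup.of 1) ^ 2) = 1 :=
    PresentedGroup.one_of_mem (by simp [kitegridRels])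
  rw [map_pow, pow_two] at this
  exact this

theorem γ_mul_self : γ * γ = 1 := by
  have : (PresentedGroup.mk kitegridRels) ((FreeGroup.of 2) ^ 2) = 1 :=
    PresentedGroup.one_of_mem (by simp [kitegridRels])
  rw [map_pow, pow_two] at this
  exact this

theorem αβ_pow_six : (α * β) ^ 6 = 1 := by
  have : (PresentedGroup.mk kitegridRels) ((FreeGroup.of 0 * FreeGroup.of 1) ^ 6) = 1 :=
    PresentedGroup.one_of_mem (by simp [kitegridRels])
  rw [map_pow, map_mul] at this
  exact this

theorem βγ_pow_three : (β * γ) ^ 3 = 1 := by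
  have : (PresentedGroup.mk kitegridRels) ((FreeGroup.of 1 * FreeGroup.of 2) ^ 3) = 1 :=
    PresentedGroup.one_of_mem (by simp [kitegridRels])
  rw [map_pow, map_mul] at this
  exact this

theorem αγ_sq : (α * γ) ^ 2 = 1 := by
  have : (PresentedGroup.mk kitegridRels) ((FreeGroup.of 0 * FreeGroup.of 2) ^ 2) = 1 :=
    PresentedGroup.one_of_mem (by simp [kitegridRels])
  rw [map_pow, map_mul] at this
  exact this

theorem α_inv : α⁻¹ = α := inv_eq_of_mul_eq_one_left α_mul_self
theorem β_inv : β⁻¹ = β := inv_eq_of_mul_eq_one_left β_mul_self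
theorem γ_inv : γ⁻¹ = γ := inv_eq_of_mul_eq_one_left γ_mul_self

theorem R6_inv : R6⁻¹ = α * β := by rw [R6, mul_inv_rev, α_inv, β_inv]
theorem R3_inv : R3⁻¹ = β * γ := by rw [R3, mul_inv_rev, γ_inv, β_inv]

theorem R6_pow_six : R6 ^ 6 = 1 := by
  rw [← inv_inv R6, R6_inv, inv_pow, αβ_pow_six, inv_one]

theorem R3_pow_three : R3 ^ 3 = 1 := by
  rw [← inv_inv R3, R3_inv, inv_pow, βγ_pow_three, inv_one]

theorem γ_mul_α : γ * α = α * γ := by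
  have h := αγ_sq
  rw [pow_two, mul_assoc] at h
  calc γ * α = α * (α * (γ * (α * γ))) * γ := by
        simp only [← mul_assoc, α_mul_self, one_mul]
        rw [mul_assoc (γ * α), γ_mul_self, mul_one]
    _ = α * γ := by rw [h, mul_one]

theorem R3_mul_R6 : R3 * R6 = α * γ := by
  rw [R3, R6, mul_assoc, ← mul_assoc β, β_mul_self, one_mul, γ_mul_α]

theorem R6_mul_R3 : R6 * R3 = R3⁻¹ * R6⁻¹ := by
  have h : R3 * R6 * (R3 * R6) = 1 := by rw [R3_mul_R6, ← pow_two, αγ_sq]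
  have h2 : R6 * R3 = R3⁻¹ * (R3 * R6 * (R3 * R6)) * R6⁻¹ := by group
  rw [h2, h, mul_one]

end KitegridGroup

namespace KitegridGroup

/-- Translation by `1` in `Γ⁺`. -/
def T1 : KitegridGroup := R3 * R6⁻¹ * R6⁻¹
/-- Translation by `ω` in `Γ⁺`. -/
def T2 : KitegridGroup := R6 * T1 * R6⁻¹

theorem R3_mul_R3 : R3 * R3 = R3⁻¹ := by
  have h := R3_pow_three
  rw [pow_succ, pow_two] at h
  exact eq_inv_of_mul_eq_one_left h

theorem R3_mul_R6_eq : R3 * R6 = R6⁻¹ * R3⁻¹ := by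
  have : R3 * R6 = R3 * (R6 * R3) * R3⁻¹ := by group
  rw [this, R6_mul_R3, mul_inv_cancel_left]

theorem R6_mul_T1 : R6 * T1 = T2 * R6 := by rw [T2]; group

theorem R6_neg_four : R6⁻¹ * R6⁻¹ * R6⁻¹ * R6⁻¹ = R6 * R6 := by
  have : R6⁻¹ * R6⁻¹ * R6⁻¹ * R6⁻¹ = (R6 ^ 6)⁻¹ * (R6 * R6) := by group
  rw [this, R6_pow_six, inv_one, one_mul]

theorem R6_four : R6 * R6 * R6 * R6 = R6⁻¹ * R6⁻¹ := by
  rw [← inv_inj]; simpa [mul_assoc] using R6_neg_four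

theorem T2_eq : T2 = R3⁻¹ * (R6 * R6) := by
  have : T2 = R3⁻¹ * (R6⁻¹ * R6⁻¹ * R6⁻¹ * R6⁻¹) := by
    rw [T2, T1]; simp only [← mul_assoc]; rw [R6_mul_R3]
  rw [this, R6_neg_four]

theorem T2_mul_T1_inv : T2 * T1⁻¹ = R6 * R3⁻¹ * R6 := by
  calc T2 * T1⁻¹ = R3⁻¹ * (R6 * R6 * R6 * R6) * R3⁻¹ := by
        rw [T2_eq, T1]; simp [mul_assoc]
    _ = (R3⁻¹ * R6⁻¹) * (R6⁻¹ * R3⁻¹) := by rw [R6_four]; simp only [mul_assoc]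
    _ = R6 * (R3 * R3) * R6 := by
        rw [← R6_mul_R3, ← R3_mul_R6_eq]; simp only [mul_assoc]
    _ = R6 * R3⁻¹ * R6 := by rw [R3_mul_R3]

theorem R6_mul_T2 : R6 * T2 = T2 * T1⁻¹ * R6 := by
  rw [T2_mul_T1_inv, T2_eq]; simp only [mul_assoc]

theorem T1_mul_T2 : T1 * T2 = T2 * T1 := by
  have h : R6 * (T2 * T1⁻¹) * R6⁻¹ = T1⁻¹ := by
    rw [T2_mul_T1_inv, T1]; simp [mul_assoc]
  have h2 : R6 * (T2 * T1⁻¹) * R6⁻¹ = T2 * T1⁻¹ * T2⁻¹ := by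
    have h1 : R6 * T1 * R6⁻¹ = T2 := rfl
    calc _ = (R6 * T2 * R6⁻¹) * (R6 * T1 * R6⁻¹)⁻¹ := by group
      _ = _ := by rw [R6_mul_T2, h1]; group
  rw [h2] at h
  have h3 : T2 * T1⁻¹ = T1⁻¹ * T2 := by rw [← mul_inv_eq_iff_eq_mul, h]
  rw [← mul_right_inj T1⁻¹, ← mul_left_inj T1⁻¹]
  simp only [mul_assoc, mul_inv_cancel, mul_one, inv_mul_cancel_left]
  exact h3

/-- Translation by `v.1 + v.2 * ω` in `Γ⁺`. -/
def T (v : ℤ × ℤ) : KitegridGroup := T1 ^ v.1 * T2 ^ v.2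

theorem commute_T1_T2 : Commute T1 T2 := T1_mul_T2

theorem T_add (v w : ℤ × ℤ) : T (v + w) = T v * T w := by
  have h : T2 ^ v.2 * T1 ^ w.1 = T1 ^ w.1 * T2 ^ v.2 :=
    (commute_T1_T2.symm.zpow_zpow _ _)
  simp only [T, Prod.fst_add, Prod.snd_add, zpow_add]
  rw [mul_assoc (T1 ^ v.1) (T1 ^ w.1), ← mul_assoc (T1 ^ w.1), ← h]
  simp only [mul_assoc]

theorem R6_mul_T (v : ℤ × ℤ) : R6 * T v = T (rot 1 v) * R6 := by
  have e1 : R6 * T1 * R6⁻¹ = T2 := rfl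
  have e2 : R6 * T2 * R6⁻¹ = T2 * T1⁻¹ := by rw [R6_mul_T2]; group
  have h1 : R6 * T1 ^ v.1 * R6⁻¹ = T2 ^ v.1 := by rw [← conj_zpow, e1]
  have h2 : R6 * T2 ^ v.2 * R6⁻¹ = T2 ^ v.2 * T1 ^ (-v.2) := by
    rw [← conj_zpow, e2, (commute_T1_T2.symm.inv_right).mul_zpow, inv_zpow']
  have h3 : T (rot 1 v) = T2 ^ v.1 * (T2 ^ v.2 * T1 ^ (-v.2)) := by
    simp only [T, HexModule.rot_eq_rotInt, HexModule.rotInt_one]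
    rw [(commute_T1_T2.zpow_zpow _ _), zpow_add, mul_assoc]
  rw [h3, ← h1, ← h2, T]; group

theorem R6_pow_mul_T (n : ℕ) (v : ℤ × ℤ) : R6 ^ n * T v = T (rot n v) * R6 ^ n := by
  induction n with
  | zero => simp
  | succ n ih =>
    rw [pow_succ', mul_assoc, ih, ← mul_assoc, R6_mul_T, HexModule.rot_rot, mul_assoc,
      Nat.cast_succ, add_comm]

/-- The element of `Γ⁺` with a given kite. -/
def el : Kite →* KitegridGroup where
  toFun g := T g.pos * R6 ^ g.dir.val
  map_one' := by simp [T]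
  map_mul' g h := by
    have h1 : R6 ^ (g * h).dir.val = R6 ^ g.dir.val * R6 ^ h.dir.val := by
      rw [Frame.mul_dir, ZMod.val_add, ← pow_add]
      exact (pow_eq_pow_mod _ R6_pow_six).symm
    have h2 := R6_pow_mul_T g.dir.val h.pos
    rw [ZMod.natCast_zmod_val] at h2
    rw [h1, Frame.mul_pos, T_add]
    simp only [mul_assoc]
    rw [← mul_assoc (R6 ^ g.dir.val), h2]
    simp only [mul_assoc]

theorem el_apply (g : Kite) : el g = T g.pos * R6 ^ g.dir.val := rfl

theorem el_R6 : el ⟨(0, 0), 1⟩ = R6 := by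
  rw [el_apply]; simp [T, ZMod.val_one'']

theorem el_R3 : el ⟨(1, 0), 2⟩ = R3 := by
  rw [el_apply, show (2 : ZMod 6).val = 2 from rfl]; simp only [T, T1]; group

/-- The hexagonal lattice automorphisms by which `α, β, γ` act. -/
def refl (k : Fin 3) : Equiv.Perm (ℤ × ℤ) :=
  match k with
  | 0 => Function.Involutive.toPerm (fun v => (v.1 + v.2, -v.2)) (fun v => by ext <;> simp)
  | 1 => Function.Involutive.toPerm (fun v => (v.2, v.1)) (fun v => by ext <;> simp)
  | 2 => Function.Involutive.toPerm (fun v => (1 - v.1 - v.2, v.2)) (fun v => by ext <;> simp; ring)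

theorem refl_zero (v : ℤ × ℤ) : refl 0 v = (v.1 + v.2, -v.2) := rfl
theorem refl_one (v : ℤ × ℤ) : refl 1 v = (v.2, v.1) := rfl
theorem refl_two (v : ℤ × ℤ) : refl 2 v = (1 - v.1 - v.2, v.2) := rfl

theorem refl_rels : ∀ r ∈ kitegridRels, FreeGroup.lift refl r = 1 := by
  intro r hr
  simp only [kitegridRels, Set.mem_insert_iff, Set.mem_singleton_iff] at hr
  rcases hr with rfl | rfl | rfl | rfl | rfl | rfl <;> ext v <;>
    simp only [map_mul, FreeGroup.lift_apply_of, pow_succ, pow_zero, one_mul,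
      Equiv.Perm.mul_apply, Equiv.Perm.one_apply, refl_zero, refl_one, refl_two] <;> ring

/-- The action of the Kitegrid group on hexagon centres. -/
def act : KitegridGroup →* Equiv.Perm (ℤ × ℤ) := PresentedGroup.toGroup refl_rels

theorem act_R6 (v : ℤ × ℤ) : act R6 v = rot 1 v := by
  have : act R6 = refl 1 * refl 0 := by
    rw [R6, map_mul]; rfl
  rw [this, Equiv.Perm.mul_apply, refl_zero, refl_one]; rfl

theorem act_R3 (v : ℤ × ℤ) : act R3 v = (1, 0) + rot 2 v := by
  have : act R3 = refl 2 * refl 1 := by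
    rw [R3, map_mul]; rfl
  rw [this, Equiv.Perm.mul_apply, refl_one, refl_two]
  ext <;> simp; ring

theorem act_T1 (v : ℤ × ℤ) : act T1 v = (1, 0) + v := by
  have h : R3 = T1 * (R6 * R6) := by rw [T1]; group
  have h2 := act_R3 (rot (-2) v)
  rw [HexModule.rot_cancel, h, map_mul, map_mul, Equiv.Perm.mul_apply, Equiv.Perm.mul_apply,
    act_R6, act_R6, HexModule.rot_rot, HexModule.rot_rot,
    show (1 : ZMod 6) + 1 + -2 = 0 from rfl, HexModule.rot_zero] at h2
  exact h2

theorem act_T2 (v : ℤ × ℤ) : act T2 v = (0, 1) + v := by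
  have h := congrArg (fun f => act f (rot (-1) v)) R6_mul_T1
  simp only [map_mul, Equiv.Perm.mul_apply] at h
  rw [act_R6, act_R6, HexModule.rot_cancel, act_T1, HexModule.rot_add, HexModule.rot_cancel] at h
  rw [← h]; rfl

theorem zpow_translation {f : Equiv.Perm (ℤ × ℤ)} {p : ℤ × ℤ} (h : ∀ v, f v = p + v) (n : ℤ)
    (v : ℤ × ℤ) : (f ^ n) v = n • p + v := by
  induction n generalizing v with
  | zero => simp
  | succ n ih => rw [zpow_add_one, Equiv.Perm.mul_apply, h, ih, add_smul, one_smul, add_assoc]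
  | pred n ih =>
    have h2 : f⁻¹ v = -p + v := by rw [Equiv.Perm.inv_eq_iff_eq, h, add_neg_cancel_left]
    rw [zpow_sub_one, Equiv.Perm.mul_apply, h2, ih, sub_smul, one_smul, sub_eq_add_neg, add_assoc]

theorem act_T1_zpow (n : ℤ) (v : ℤ × ℤ) : act (T1 ^ n) v = (n, 0) + v := by
  rw [map_zpow, zpow_translation act_T1]
  ext <;> simp

theorem act_T2_zpow (n : ℤ) (v : ℤ × ℤ) : act (T2 ^ n) v = (0, n) + v := by
  rw [map_zpow, zpow_translation act_T2]
  ext <;> simp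

theorem act_R6_pow (n : ℕ) (v : ℤ × ℤ) : act (R6 ^ n) v = rot n v := by
  induction n with
  | zero => simp
  | succ n ih =>
    rw [pow_succ', map_mul, Equiv.Perm.mul_apply, ih, act_R6, HexModule.rot_rot, Nat.cast_succ,
      add_comm]

theorem act_el (g : Kite) (v : ℤ × ℤ) : act (el g) v = g.pos + rot g.dir v := by
  rw [el_apply, T, map_mul, map_mul, Equiv.Perm.mul_apply, Equiv.Perm.mul_apply, act_R6_pow,
    act_T2_zpow, act_T1_zpow, ZMod.natCast_zmod_val]
  ext <;> simp

theorem el_injective : Function.Injective el := by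
  intro g h hgh
  have h0 := act_el g 0
  have h1 := act_el g (1, 0)
  rw [hgh, act_el, HexModule.rot_of_zero, HexModule.rot_of_zero, add_zero, add_zero] at h0
  rw [hgh, act_el, h0, add_right_inj] at h1
  ext1
  · exact h0.symm
  · obtain ⟨p, k⟩ := g
    obtain ⟨q, l⟩ := h
    simp only at h1 ⊢
    clear h0 hgh
    revert k l
    decide

theorem range_el : el.range = Γplus := by
  apply le_antisymm
  · rintro _ ⟨g, rfl⟩
    have h6 : R6 ∈ Γplus := Subgroup.subset_closure (by simp)
    have h3 : R3 ∈ Γplus := Subgroup.subset_closure (by simp)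
    have hT1 : T1 ∈ Γplus := mul_mem (mul_mem h3 (inv_mem h6)) (inv_mem h6)
    have hT2 : T2 ∈ Γplus := mul_mem (mul_mem h6 hT1) (inv_mem h6)
    exact mul_mem (mul_mem (zpow_mem hT1 _) (zpow_mem hT2 _)) (pow_mem h6 _)
  · rw [Γplus, Subgroup.closure_le]
    rintro _ (rfl | rfl)
    · exact ⟨_, el_R6⟩
    · exact ⟨_, el_R3⟩

end KitegridGroup

namespace Hat

/-- The eight kites of the hat (`t = false`) and of the reflected hat (`t = true`). -/
def tile (t : Bool) (i : Fin 8) : Kite :=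
  match t, i.val with
  | false, 0 => ⟨(0, 0), 0⟩
  | false, 1 => ⟨(0, 0), 1⟩
  | false, 2 => ⟨(0, 0), 5⟩
  | false, 3 => ⟨(0, 0), 4⟩
  | false, 4 => ⟨(1, 0), 2⟩
  | false, 5 => ⟨(0, 1), 4⟩
  | false, 6 => ⟨(1, 0), 1⟩
  | false, _ => ⟨(0, 1), 3⟩
  | true, 0 => ⟨(0, 0), 5⟩
  | true, 1 => ⟨(0, 0), 4⟩
  | true, 2 => ⟨(0, 0), 0⟩
  | true, 3 => ⟨(0, 0), 1⟩
  | true, 4 => ⟨(1, 0), 3⟩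
  | true, 5 => ⟨(1, -1), 1⟩
  | true, 6 => ⟨(1, 0), 4⟩
  | true, _ => ⟨(1, -1), 2⟩

/-- `D` is the set of placements of a tiling of the Kitegrid by hats and reflected hats. -/
def IsTiling (D : Set (Kite × Bool)) : Prop :=
  ∀ g : Kite, ∃! q : (Kite × Bool) × Fin 8, q.1 ∈ D ∧ q.1.1 * tile q.1.2 q.2 = g

theorem forall_fin8 {p : Fin 8 → Prop} :
    (∀ k, p k) ↔ p 0 ∧ p 1 ∧ p 2 ∧ p 3 ∧ p 4 ∧ p 5 ∧ p 6 ∧ p 7 := by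
  constructor
  · intro h; exact ⟨h 0, h 1, h 2, h 3, h 4, h 5, h 6, h 7⟩
  · rintro ⟨h0, h1, h2, h3, h4, h5, h6, h7⟩ k
    fin_cases k <;> assumption

theorem range_fin8 {X : Type*} (f : Fin 8 → X) :
    Set.range f = {f 0, f 1, f 2, f 3, f 4, f 5, f 6, f 7} := by
  ext x
  simp only [Set.mem_range, Set.mem_insert_iff, Set.mem_singleton_iff]
  constructor
  · rintro ⟨i, rfl⟩
    revert i
    rw [forall_fin8]
    simp
  · rintro (h | h | h | h | h | h | h | h) <;> exact ⟨_, h.symm⟩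

theorem hatPlus_eq : hatPlus = Set.range fun i => el (tile false i) := by
  rw [range_fin8, hatPlus, ← el_R6, ← el_R3, ← map_one el]
  simp only [← map_inv, ← map_mul]
  rfl

theorem α_mul_R6_mul_α : α * R6 * α = R6⁻¹ := by
  rw [R6_inv, R6, mul_assoc, mul_assoc, α_mul_self, mul_one]

theorem α_mul_R3_mul_α : α * R3 * α = R3 * R6 * R6 := by
  rw [R3_mul_R6, R3, R6, ← γ_mul_α, ← mul_assoc, ← γ_mul_α]
  simp only [mul_assoc]

theorem hatPlusRefl_eq : hatPlusRefl = Set.range fun i => el (tile true i) := by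
  have hβ : β = α * R6⁻¹ := by rw [R6_inv, ← mul_assoc, α_mul_self, one_mul]
  have h6 : MulAut.conj α R6 = R6⁻¹ := by rw [MulAut.conj_apply, α_inv, α_mul_R6_mul_α]
  have h3 : MulAut.conj α R3 = R3 * R6 * R6 := by rw [MulAut.conj_apply, α_inv, α_mul_R3_mul_α]
  have h (g : KitegridGroup) : α * g * β = MulAut.conj α g * R6⁻¹ := by
    rw [hβ, MulAut.conj_apply, α_inv]; simp only [mul_assoc]
  simp only [hatPlusRefl, hatPlus, Set.image_insert_eq, Set.image_singleton, h, map_mul, map_inv,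
    h6, h3, map_one]
  rw [range_fin8, ← el_R6, ← el_R3, ← map_one el]
  simp only [← map_inv, ← map_mul]
  rfl

theorem hatPlusRefl_subset : hatPlusRefl ⊆ (Γplus : Set KitegridGroup) := by
  rw [hatPlusRefl_eq, ← range_el]
  rintro _ ⟨i, rfl⟩
  exact ⟨_, rfl⟩

theorem smul_hatPlus_ne : ¬ ∃ c ∈ Γplus, c • hatPlus = hatPlusRefl := by
  rintro ⟨c, hc, h⟩
  rw [← range_el] at hc
  obtain ⟨g, rfl⟩ := hc
  rw [hatPlus_eq, hatPlusRefl_eq] at h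
  have key (j : Fin 8) : ∃ i, g * tile false j = tile true i := by
    have : el g * el (tile false j) ∈ Set.range fun i => el (tile true i) := by
      rw [← h]; exact Set.smul_mem_smul_set ⟨j, rfl⟩
    obtain ⟨i, hi⟩ := this
    exact ⟨i, el_injective (by rw [map_mul, ← hi])⟩
  obtain ⟨i, hi⟩ := key 0
  rw [show tile false 0 = 1 from rfl, mul_one] at hi
  subst hi
  clear h
  revert i
  decide +kernel

/-- The two tiles in `Γ⁺`. -/
def tileSet (t : Bool) : Set KitegridGroup := Set.range fun i => el (tile t i)

theorem tileSet_injective : Function.Injective tileSet := by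
  have h : hatPlus ≠ hatPlusRefl := fun h => smul_hatPlus_ne ⟨1, one_mem _, by rw [one_smul, h]⟩
  rw [hatPlus_eq, hatPlusRefl_eq] at h
  rintro (_ | _) (_ | _) h2
  · rfl
  · exact absurd h2 h
  · exact absurd h2.symm h
  · rfl

theorem tile_injective (t : Bool) : Function.Injective (tile t) := by
  revert t; decide +kernel

theorem mem_smul_tileSet {g x : Kite} {t : Bool} :
    el x ∈ el g • tileSet t ↔ ∃ i, g * tile t i = x := by
  rw [Set.mem_smul_set]
  constructor
  · rintro ⟨_, ⟨i, rfl⟩, h⟩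
    exact ⟨i, el_injective (by rw [← h, map_mul]; rfl)⟩
  · rintro ⟨i, rfl⟩
    exact ⟨_, ⟨i, rfl⟩, by rw [map_mul]; rfl⟩

theorem isCotiler2_of_isTiling {D : Set (Kite × Bool)} (hD : IsTiling D) :
    IsCotiler2 ((fun q : Kite × Bool => (el q.1, tileSet q.2)) '' D) := by
  refine ⟨?_, ?_, ?_⟩
  · rintro _ ⟨⟨g, t⟩, -, rfl⟩
    refine ⟨?_, ?_⟩
    · rw [← range_el]; exact ⟨g, rfl⟩
    · rw [hatPlus_eq, hatPlusRefl_eq]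
      cases t
      · exact Or.inl rfl
      · exact Or.inr rfl
  · rintro _ ⟨⟨g, t⟩, hg, rfl⟩ _ ⟨⟨g', t'⟩, hg', rfl⟩ hne
    rw [Set.disjoint_left]
    rintro _ ⟨_, ⟨i, rfl⟩, rfl⟩ h
    change el g * el (tile t i) ∈ el g' • tileSet t' at h
    rw [← map_mul, mem_smul_tileSet] at h
    obtain ⟨j, hj⟩ := h
    have := (hD (g * tile t i)).unique (y₁ := ((g, t), i)) (y₂ := ((g', t'), j)) ⟨hg, rfl⟩ ⟨hg', hj⟩
    simp only [Prod.mk.injEq] at this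
    obtain ⟨⟨rfl, rfl⟩, -⟩ := this
    exact hne rfl
  · ext x
    simp only [Set.mem_iUnion]
    constructor
    · rintro ⟨_, ⟨⟨g, t⟩, -, rfl⟩, ⟨_, ⟨i, rfl⟩, rfl⟩⟩
      rw [← range_el]
      exact ⟨g * tile t i, map_mul _ _ _⟩
    · intro hx
      rw [← range_el] at hx
      obtain ⟨x, rfl⟩ := hx
      obtain ⟨⟨⟨g, t⟩, i⟩, ⟨hg, hi⟩, -⟩ := hD x
      exact ⟨_, ⟨_, hg, rfl⟩, mem_smul_tileSet.2 ⟨i, hi⟩⟩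

theorem isTiling_of_isCotiler2 {C : Set (KitegridGroup × Set KitegridGroup)} (hC : IsCotiler2 C) :
    IsTiling {q : Kite × Bool | (el q.1, tileSet q.2) ∈ C} := by
  obtain ⟨hsub, hdisj, hcov⟩ := hC
  intro x
  have hx : el x ∈ (Γplus : Set KitegridGroup) := by rw [← range_el]; exact ⟨x, rfl⟩
  rw [← hcov] at hx
  simp only [Set.mem_iUnion] at hx
  obtain ⟨⟨c, U⟩, hp, hx⟩ := hx
  obtain ⟨hc, hU⟩ := hsub hp
  rw [← range_el] at hc
  obtain ⟨g, rfl⟩ := hc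
  obtain ⟨t, rfl⟩ : ∃ t, U = tileSet t := by
    rw [hatPlus_eq, hatPlusRefl_eq] at hU
    rcases hU with hU | hU
    · exact ⟨false, hU⟩
    · exact ⟨true, hU⟩
  obtain ⟨i, hi⟩ := mem_smul_tileSet.1 hx
  refine ⟨((g, t), i), ⟨hp, hi⟩, ?_⟩
  rintro ⟨⟨g', t'⟩, j⟩ ⟨hp', hj⟩
  by_cases h : ((el g', tileSet t') : KitegridGroup × Set KitegridGroup) = (el g, tileSet t)
  · rw [Prod.mk.injEq] at h
    obtain rfl := el_injective h.1
    obtain rfl := tileSet_injective h.2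
    rw [← hi, mul_right_inj] at hj
    rw [show j = i from tile_injective _ hj]
  · exact absurd (mem_smul_tileSet.2 ⟨i, hi⟩)
      (Set.disjoint_left.1 (hdisj _ hp' _ hp h) (mem_smul_tileSet.2 ⟨j, hj⟩))

/-- The symmetries of a set of placements. -/
def symmetries (D : Set (Kite × Bool)) : Set Kite := {h | ∀ g t, (h * g, t) ∈ D ↔ (g, t) ∈ D}

theorem finite_stabilizer {C : Set (KitegridGroup × Set KitegridGroup)}
    (h : (symmetries {q : Kite × Bool | (el q.1, tileSet q.2) ∈ C}).Finite) :
    {h : KitegridGroup | h ∈ Γplus ∧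
      (fun p : KitegridGroup × Set KitegridGroup => (h * p.1, p.2)) '' C = C}.Finite := by
  refine (h.image el).subset ?_
  rintro x ⟨hx, hxC⟩
  rw [← range_el] at hx
  obtain ⟨x, rfl⟩ := hx
  refine ⟨x, fun g t => ?_, rfl⟩
  have hinj : Function.Injective
      (fun p : KitegridGroup × Set KitegridGroup => (el x * p.1, p.2)) := by
    rintro ⟨a, U⟩ ⟨b, W⟩ h
    simpa using h
  change (el (x * g), tileSet t) ∈ C ↔ (el g, tileSet t) ∈ C
  rw [map_mul]
  nth_rw 1 [← hxC]
  exact hinj.mem_set_image (a := (el g, tileSet t))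

end Hat

/-- The sign representation. -/
instance : HexModule ℤ where
  rot k n := if k = 0 ∨ k = 2 ∨ k = 4 then n else -n
  rot_zero _ := rfl
  rot_rot k l n := by
    revert k l
    simp only [HexModule.forall_zmod6]
    simp +decide
  rot_add k v w := by
    split_ifs <;> ring

namespace Hat

/-- Values of formal boundary displacements: the first coordinate pair and the second one are
rotated by a kite, the last coordinate is multiplied by the sign. -/
abbrev Pot := (ℤ × ℤ) × (ℤ × ℤ) × ℤ

/-- Displacements from the first vertex of a kite to the remaining three. -/
@[ext] structure KitePot where
  a : Pot
  b : Pot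
  c : Pot

/-- The displacements attached to each kite of a tile, in the frame of the kite. -/
def pot (l : Bool × Fin 8) : KitePot :=
  match l.1, l.2.val with
  | false, 0 => ⟨((3, 0), (0, -1), 0), 0, 0⟩
  | false, 1 => ⟨0, ((1, -1), (0, 1), -1), ((0, 0), (0, 1), 0)⟩
  | false, 2 => ⟨((1, 1), (1, -1), 0), ((1, 2), (1, -1), -1), ((0, 3), (1, -1), 0)⟩
  | false, 3 => ⟨((0, 0), (1, 0), 0), ((0, 1), (1, 0), -1), ((-1, 2), (1, 0), 0)⟩
  | false, 4 => ⟨((1, 1), (1, -1), 0), ((0, 3), (1, 0), 0), ((0, 0), (0, 1), 0)⟩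
  | false, 5 => ⟨((2, -1), (1, 0), 0), ((2, -1), (1, 0), 0), ((0, 0), (0, 1), 0)⟩
  | false, 6 => ⟨((0, 0), (1, 0), 0), ((0, 1), (1, 0), -1), ((-1, 2), (1, 0), 0)⟩
  | false, _ => ⟨((0, 0), (1, 0), 0), ((0, 1), (1, 0), -1), ((1, 1), (0, 1), 0)⟩
  | true, 0 => ⟨0, 0, ((3, 0), (-1, 0), 0)⟩
  | true, 1 => ⟨((0, 0), (1, 0), 0), ((0, 1), (1, 0), -1), 0⟩
  | true, 2 => ⟨((3, -3), (-1, 1), 0), ((3, -2), (-1, 1), -1), ((2, -1), (-1, 1), 0)⟩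
  | true, 3 => ⟨((1, -2), (0, 1), 0), ((1, -1), (0, 1), -1), ((0, 0), (0, 1), 0)⟩
  | true, 4 => ⟨((0, 0), (1, 0), 0), ((3, -3), (0, 1), 0), ((2, -1), (-1, 1), 0)⟩
  | true, 5 => ⟨((0, 0), (1, 0), 0), ((1, 1), (0, 1), 0), ((1, 1), (0, 1), 0)⟩
  | true, 6 => ⟨((1, -2), (0, 1), 0), ((1, -1), (0, 1), -1), ((0, 0), (0, 1), 0)⟩
  | true, _ => ⟨((2, -1), (1, 0), 0), ((1, -1), (0, 1), -1), ((0, 0), (0, 1), 0)⟩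

/-- The kite `⟨(0, 0), 1⟩`, i.e. `R6`. -/
def r6 : Kite := ⟨(0, 0), 1⟩
/-- The kite `⟨(1, 0), 2⟩`, i.e. `R3`. -/
def r3 : Kite := ⟨(1, 0), 2⟩

/-- The labelling of kites by their position in their tile is compatible with the tiles. -/
def Consistent (f : Kite → Bool × Fin 8) : Prop :=
  ∀ g i, f (g * ((tile (f g).1 (f g).2)⁻¹ * tile (f g).1 i)) = ((f g).1, i)

/-- Displacement along a long outer edge of a tile. -/
def longEdge : Pot := ((0, 0), (1, 0), 0)
/-- Displacement along a short outer edge of a tile. -/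
def shortEdge : Pot := ((0, -1), (0, 0), 1)

theorem pot_long_right : ∀ t i, (∃ j, (tile t i)⁻¹ * tile t j = r6 ∧
    (pot (t, i)).c = rot 1 (pot (t, j)).a) ∨ (pot (t, i)).c = rot 1 longEdge := by
  decide +kernel

theorem pot_long_left : ∀ t i, (∃ j, (tile t i)⁻¹ * tile t j = r6⁻¹ ∧
    (pot (t, j)).c = rot 1 (pot (t, i)).a) ∨ (pot (t, i)).a = longEdge := by
  decide +kernel

theorem pot_short_right : ∀ t i, (∃ j, (tile t i)⁻¹ * tile t j = r3 ∧
    (pot (t, i)).a - (pot (t, i)).b = rot 2 ((pot (t, j)).c - (pot (t, j)).b)) ∨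
    (pot (t, i)).a - (pot (t, i)).b = shortEdge := by
  decide +kernel

theorem pot_short_left : ∀ t i, (∃ j, (tile t i)⁻¹ * tile t j = r3⁻¹ ∧
    (pot (t, j)).a - (pot (t, j)).b = rot 2 ((pot (t, i)).c - (pot (t, i)).b)) ∨
    rot 2 ((pot (t, i)).c - (pot (t, i)).b) = shortEdge := by
  decide +kernel

theorem Consistent.eq {f : Kite → Bool × Fin 8} (hf : Consistent f) {g s : Kite} {j : Fin 8}
    (h : (tile (f g).1 (f g).2)⁻¹ * tile (f g).1 j = s) : f (g * s) = ((f g).1, j) := by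
  rw [← h, hf]

theorem Consistent.pot_r6 {f : Kite → Bool × Fin 8} (hf : Consistent f) (g : Kite) :
    (pot (f g)).c = rot 1 (pot (f (g * r6))).a := by
  rcases pot_long_right (f g).1 (f g).2 with ⟨j, hj, h⟩ | h
  · rw [hf.eq hj]; exact h
  rcases pot_long_left (f (g * r6)).1 (f (g * r6)).2 with ⟨j, hj, h2⟩ | h2
  · have := hf.eq hj
    rw [mul_inv_cancel_right] at this
    rw [this]; exact h2
  · exact h.trans (congrArg (rot 1) h2.symm)

theorem Consistent.pot_r3 {f : Kite → Bool × Fin 8} (hf : Consistent f) (g : Kite) :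
    (pot (f g)).a - (pot (f g)).b =
      rot 2 ((pot (f (g * r3))).c - (pot (f (g * r3))).b) := by
  rcases pot_short_right (f g).1 (f g).2 with ⟨j, hj, h⟩ | h
  · rw [hf.eq hj]; exact h
  rcases pot_short_left (f (g * r3)).1 (f (g * r3)).2 with ⟨j, hj, h2⟩ | h2
  · have := hf.eq hj
    rw [mul_inv_cancel_right] at this
    rw [this]; exact h2
  · exact h.trans h2.symm

end Hat

namespace Hat

open Finset

/-! ### Sums over a fundamental domain -/

/-- Invariance under the sublattice `N ℤ²`. -/
def Periodic₂ {X : Type*} (N : ℕ) (F : ℤ × ℤ → X) : Prop :=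
  ∀ z, F (z + ((N : ℤ), 0)) = F z ∧ F (z + (0, (N : ℤ))) = F z

/-- The sum over an `N × N` box. -/
def boxSum {M : Type*} [AddCommMonoid M] (N : ℕ) (F : ℤ × ℤ → M) : M :=
  ∑ i ∈ range N, ∑ j ∈ range N, F (i, j)

theorem sum_range_shift {M : Type*} [AddCommGroup M] {N : ℕ} {f : ℤ → M}
    (hf : ∀ x, f (x + N) = f x) (m : ℤ) : ∑ i ∈ range N, f (i + m) = ∑ i ∈ range N, f i := by
  have step (f : ℤ → M) (hf : ∀ x, f (x + N) = f x) :
      ∑ i ∈ range N, f (i + 1) = ∑ i ∈ range N, f i := by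
    have h1 := Finset.sum_range_succ (fun i : ℕ => f i) N
    have h2 := Finset.sum_range_succ' (fun i : ℕ => f i) N
    have h3 := hf 0
    simp only [Nat.cast_add, Nat.cast_one, zero_add, Nat.cast_zero] at h1 h2 h3
    rw [h1, h3] at h2
    exact (add_right_cancel h2).symm
  have hper (m x : ℤ) : f (x + N + m) = f (x + m) := by rw [add_right_comm, hf]
  induction m with
  | zero => simp
  | succ m ih =>
    rw [← ih, ← step (fun x => f (x + m)) (hper m)]
    simp only [add_assoc, add_comm (1 : ℤ)]
  | pred m ih =>
    rw [← ih, ← step (fun x => f (x + (-m - 1))) (hper _)]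
    refine Finset.sum_congr rfl fun i _ => ?_
    congr 1; ring

theorem boxSum_shift {M : Type*} [AddCommGroup M] {N : ℕ} {F : ℤ × ℤ → M} (hF : Periodic₂ N F)
    (p : ℤ × ℤ) : boxSum N (fun z => F (z + p)) = boxSum N F := by
  have h1 (x y : ℤ) : F (x + N, y) = F (x, y) := by simpa using (hF (x, y)).1
  have h2 (x y : ℤ) : F (x, y + N) = F (x, y) := by simpa using (hF (x, y)).2
  simp only [boxSum]
  calc ∑ i ∈ range N, ∑ j ∈ range N, F (i + p.1, j + p.2)
      = ∑ i ∈ range N, ∑ j ∈ range N, F (i + p.1, j) :=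
        Finset.sum_congr rfl fun i _ => sum_range_shift (f := fun y => F (i + p.1, y)) (h2 _) p.2
    _ = ∑ i ∈ range N, ∑ j ∈ range N, F (i, j) :=
        sum_range_shift (f := fun x => ∑ j ∈ range N, F (x, j)) (fun x => by simp only [h1]) p.1

theorem boxSum_add {M : Type*} [AddCommMonoid M] (N : ℕ) (F G : ℤ × ℤ → M) :
    boxSum N (fun z => F z + G z) = boxSum N F + boxSum N G := by
  simp only [boxSum, Finset.sum_add_distrib]

theorem boxSum_sub {M : Type*} [AddCommGroup M] (N : ℕ) (F G : ℤ × ℤ → M) :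
    boxSum N (fun z => F z - G z) = boxSum N F - boxSum N G := by
  simp only [boxSum, Finset.sum_sub_distrib]

/-- The antisymmetric form `x ∧ y` in two coordinates. -/
def wedge {M : Type*} [AddCommGroup M] (x y : M →+ ℤ) (v w : M) : ℤ := x v * y w - y v * x w

/-- The shoelace formula for a torus. -/
theorem sum_shoelace {M : Type*} [AddCommGroup M] (x y : M →+ ℤ) {N : ℕ} {u v : ℕ → ℕ → M}
    (hc : ∀ i j, u i j + v (i + 1) j = v i j + u i (j + 1))
    (hu : ∀ i, u i N = u i 0) (hv : ∀ j, v N j = v 0 j) :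
    ∑ i ∈ range N, ∑ j ∈ range N, wedge x y (u i j + v (i + 1) j) (v i j - u i j) =
      2 * wedge x y (∑ i ∈ range N, u i 0) (∑ j ∈ range N, v 0 j) := by
  have key (i j : ℕ) : ∑ j' ∈ range j, v (i + 1) j' = ∑ j' ∈ range j, v i j' + (u i j - u i 0) := by
    rw [← Finset.sum_range_sub (fun j => u i j), ← Finset.sum_add_distrib]
    refine Finset.sum_congr rfl fun j' _ => ?_
    have := hc i j'
    rw [eq_comm, ← sub_eq_iff_eq_add'] at this
    rw [← this]; abel
  set Φ : ℕ → ℕ → M := fun i j => ∑ i' ∈ range i, u i' 0 + ∑ j' ∈ range j, v i j' with hΦ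
  have hΦ1 (i j : ℕ) : Φ (i + 1) j = Φ i j + u i j := by
    simp only [hΦ, Finset.sum_range_succ, key]; abel
  have hΦ2 (i j : ℕ) : Φ i (j + 1) = Φ i j + v i j := by
    simp only [hΦ, Finset.sum_range_succ]; abel
  have quad (i j : ℕ) : wedge x y (u i j + v (i + 1) j) (v i j - u i j) =
      (wedge x y (Φ (i + 1) j) (v (i + 1) j) - wedge x y (Φ i j) (v i j)) -
      (wedge x y (Φ i (j + 1)) (u i (j + 1)) - wedge x y (Φ i j) (u i j)) := by
    have h1 := congrArg x (hc i j)
    have h2 := congrArg y (hc i j)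
    simp only [wedge, hΦ1, hΦ2, map_add, map_sub] at h1 h2 ⊢
    rw [← sub_eq_iff_eq_add'] at h1 h2
    rw [← h1, ← h2]; ring
  have hP1 (j : ℕ) : Φ N j = Φ 0 j + ∑ i ∈ range N, u i 0 := by
    simp only [hΦ, hv]; simp [add_comm]
  have hconst (i : ℕ) : ∑ j ∈ range N, v i j = ∑ j ∈ range N, v 0 j := by
    induction i with
    | zero => rfl
    | succ i ih => rw [key, ih, hu, sub_self, add_zero]
  have hP2 (i : ℕ) : Φ i N = Φ i 0 + ∑ j ∈ range N, v 0 j := by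
    simp only [hΦ, hconst]; simp
  have s1 : ∑ i ∈ range N, ∑ j ∈ range N,
      (wedge x y (Φ (i + 1) j) (v (i + 1) j) - wedge x y (Φ i j) (v i j)) =
      ∑ j ∈ range N, wedge x y (∑ i ∈ range N, u i 0) (v 0 j) := by
    rw [Finset.sum_comm]
    refine Finset.sum_congr rfl fun j _ => ?_
    rw [Finset.sum_range_sub (fun i => wedge x y (Φ i j) (v i j)), hP1, hv]
    simp only [wedge, map_add]; ring
  have s2 : ∑ i ∈ range N, ∑ j ∈ range N,
      (wedge x y (Φ i (j + 1)) (u i (j + 1)) - wedge x y (Φ i j) (u i j)) =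
      ∑ i ∈ range N, wedge x y (∑ j ∈ range N, v 0 j) (u i 0) := by
    refine Finset.sum_congr rfl fun i _ => ?_
    rw [Finset.sum_range_sub (fun j => wedge x y (Φ i j) (u i j)), hP2, hu]
    simp only [wedge, map_add]; ring
  simp only [quad, Finset.sum_sub_distrib (f := fun i => wedge x y _ _ - wedge x y _ _)]
  rw [Finset.sum_sub_distrib, s1, s2]
  simp only [wedge, Finset.sum_sub_distrib, ← Finset.mul_sum, map_sum]
  ring

end Hat

namespace Hat

open Finset

/-- Invariance of a function on kites under the translations in `N ℤ²`. -/
def KitePeriodic {X : Type*} (N : ℕ) (F : Kite → X) : Prop :=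
  ∀ k, Periodic₂ N fun z => F ⟨z, k⟩

/-- The sum over all kites in an `N × N` box. -/
def kiteSum {M : Type*} [AddCommMonoid M] (N : ℕ) (F : Kite → M) : M :=
  boxSum N fun z => ∑ k, F ⟨z, k⟩

theorem Periodic₂.comp {X Y : Type*} {N : ℕ} {F : ℤ × ℤ → X} (hF : Periodic₂ N F) (φ : X → Y) :
    Periodic₂ N fun z => φ (F z) :=
  fun z => ⟨congrArg φ (hF z).1, congrArg φ (hF z).2⟩

theorem Periodic₂.shift {X : Type*} {N : ℕ} {F : ℤ × ℤ → X} (hF : Periodic₂ N F) (p : ℤ × ℤ) :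
    Periodic₂ N fun z => F (z + p) := fun z => by
  constructor
  · simpa only [add_right_comm z] using (hF (z + p)).1
  · simpa only [add_right_comm z] using (hF (z + p)).2

theorem Periodic₂.map₂ {X Y Z : Type*} {N : ℕ} {F : ℤ × ℤ → X} {G : ℤ × ℤ → Y}
    (hF : Periodic₂ N F) (hG : Periodic₂ N G) (φ : X → Y → Z) :
    Periodic₂ N fun z => φ (F z) (G z) := fun z => by
  simp only [(hF z).1, (hF z).2, (hG z).1, (hG z).2, and_self]

theorem KitePeriodic.comp {X Y : Type*} {N : ℕ} {F : Kite → X} (hF : KitePeriodic N F)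
    (φ : X → Y) : KitePeriodic N fun g => φ (F g) :=
  fun k => (hF k).comp φ

theorem sum_zmod6 {M : Type*} [AddCommMonoid M] (f : ZMod 6 → M) :
    ∑ k, f k = f 0 + f 1 + f 2 + f 3 + f 4 + f 5 :=
  Fin.sum_univ_six f

theorem kiteSum_eq {M : Type*} [AddCommMonoid M] (N : ℕ) (F : Kite → M) :
    kiteSum N F = ∑ k, boxSum N fun z => F ⟨z, k⟩ := by
  simp only [kiteSum, sum_zmod6, boxSum_add]

theorem kiteSum_mul_right {M : Type*} [AddCommGroup M] {N : ℕ} {F : Kite → M}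
    (hF : KitePeriodic N F) (s : Kite) : kiteSum N (fun g => F (g * s)) = kiteSum N F := by
  rw [kiteSum_eq, kiteSum_eq,
    ← Equiv.sum_comp (Equiv.addRight s.dir) fun k => boxSum N fun z => F ⟨z, k⟩]
  exact Finset.sum_congr rfl fun k _ => boxSum_shift (hF (k + s.dir)) (rot k s.pos)

/-- The area of a kite with displacements `a, b, c`. -/
def area {M : Type*} [AddCommGroup M] (x y : M →+ ℤ) (a b c : M) : ℤ :=
  wedge x y a b + wedge x y b c

theorem six_kites {M : Type*} [AddCommGroup M] (x y : M →+ ℤ)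
    {p₀ p₁ q₁ q₂ q₃ r₄ r₅ r₀ s₃ s₄ d e₁ e₂ h₄ h₅ k : M} (H₁ : p₀ - d = q₃ - e₂)
    (H₂ : q₂ - e₂ = r₅ - h₄) (H₃ : r₄ - h₄ = p₁ - d) (H₄ : q₁ - e₁ = s₄ - k)
    (H₅ : s₃ - k = r₀ - h₅) (H₆ : r₅ - h₅ = q₂ - e₁) :
    area x y p₀ d p₁ + area x y q₁ e₁ q₂ + area x y q₂ e₂ q₃ + area x y s₃ k s₄ +
      area x y r₄ h₄ r₅ + area x y r₅ h₅ r₀ =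
    wedge x y (p₀ - q₃ + (q₁ - s₄)) (p₁ - r₄ - (p₀ - q₃)) +
      (wedge x y p₀ (p₀ - q₃) - wedge x y r₀ (r₀ - s₃)) +
      (wedge x y q₁ (q₁ - s₄) - wedge x y p₁ (p₁ - r₄)) := by
  obtain rfl : e₂ = q₃ - p₀ + d := by rw [eq_sub_iff_add_eq] at H₁; rw [← H₁]; abel
  obtain rfl : k = s₄ - q₁ + e₁ := by rw [eq_sub_iff_add_eq] at H₄; rw [← H₄]; abel
  obtain rfl : h₅ = r₀ - s₃ + (s₄ - q₁ + e₁) := by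
    rw [eq_sub_iff_add_eq] at H₅; rw [← H₅]; abel
  obtain rfl : r₅ = q₂ - e₁ + (r₀ - s₃ + (s₄ - q₁ + e₁)) := by rw [← H₆]; abel
  obtain rfl : h₄ = q₂ - e₁ + (r₀ - s₃ + (s₄ - q₁ + e₁)) - q₂ + (q₃ - p₀ + d) := by
    rw [eq_sub_iff_add_eq] at H₂; rw [← H₂]; abel
  obtain rfl : r₄ = p₁ - d + (q₂ - e₁ + (r₀ - s₃ + (s₄ - q₁ + e₁)) - q₂ + (q₃ - p₀ + d)) := by
    rw [← H₃]; abel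
  simp only [area, wedge, map_add, map_sub]
  ring

theorem sum_area {M : Type*} [AddCommGroup M] {N : ℕ} {a b c : Kite → M}
    (ha : KitePeriodic N a) (hb : KitePeriodic N b) (hc : KitePeriodic N c)
    (h6 : ∀ g, c g = a (g * r6)) (h3 : ∀ g, a g - b g = c (g * r3) - b (g * r3)) :
    ∃ P Q : M, ∀ x y : M →+ ℤ,
      kiteSum N (fun g => area x y (a g) (b g) (c g)) = 2 * wedge x y P Q := by
  set u : ℤ × ℤ → M := fun z => a ⟨z, 0⟩ - c ⟨z + (1, 0), 2⟩ with hu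
  set v : ℤ × ℤ → M := fun z => c ⟨z, 0⟩ - a ⟨z + (0, 1), 4⟩ with hv
  have hup : Periodic₂ N u := (ha 0).map₂ ((hc 2).shift (1, 0)) (· - ·)
  have hvp : Periodic₂ N v := (hc 0).map₂ ((ha 4).shift (0, 1)) (· - ·)
  have e6 (z : ℤ × ℤ) (k : ZMod 6) : c ⟨z, k⟩ = a ⟨z, k + 1⟩ := by
    rw [h6]; congr 1; ext1
    · exact (congrArg (z + ·) (HexModule.rot_of_zero k)).trans (add_zero z)
    · rfl
  have f1 (z) : a ⟨z, 0⟩ - b ⟨z, 0⟩ = c ⟨z + (1, 0), 2⟩ - b ⟨z + (1, 0), 2⟩ := h3 _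
  have f2 (z) : a ⟨z + (1, 0), 2⟩ - b ⟨z + (1, 0), 2⟩ =
      c ⟨z + (0, 1), 4⟩ - b ⟨z + (0, 1), 4⟩ := by
    have := h3 ⟨z + (1, 0), 2⟩
    have e : (⟨z + (1, 0), 2⟩ : Kite) * r3 = ⟨z + (0, 1), 4⟩ := by
      ext <;> simp [r3]; rfl
    rwa [e] at this
  have f3 (z) : a ⟨z + (0, 1), 4⟩ - b ⟨z + (0, 1), 4⟩ = c ⟨z, 0⟩ - b ⟨z, 0⟩ := by
    have := h3 ⟨z + (0, 1), 4⟩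
    have e : (⟨z + (0, 1), 4⟩ : Kite) * r3 = ⟨z, 0⟩ := by
      ext <;> simp [r3]; rfl
    rwa [e] at this
  have f4 (z) : a ⟨z + (1, 0), 1⟩ - b ⟨z + (1, 0), 1⟩ =
      c ⟨z + (1, 1), 3⟩ - b ⟨z + (1, 1), 3⟩ := by
    have := h3 ⟨z + (1, 0), 1⟩
    have e : (⟨z + (1, 0), 1⟩ : Kite) * r3 = ⟨z + (1, 1), 3⟩ := by
      ext <;> simp [r3]; rfl
    rwa [e] at this
  have f5 (z) : a ⟨z + (1, 1), 3⟩ - b ⟨z + (1, 1), 3⟩ =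
      c ⟨z + (0, 1), 5⟩ - b ⟨z + (0, 1), 5⟩ := by
    have := h3 ⟨z + (1, 1), 3⟩
    have e : (⟨z + (1, 1), 3⟩ : Kite) * r3 = ⟨z + (0, 1), 5⟩ := by
      ext <;> simp [r3]; rfl
    rwa [e] at this
  have f6 (z) : a ⟨z + (0, 1), 5⟩ - b ⟨z + (0, 1), 5⟩ =
      c ⟨z + (1, 0), 1⟩ - b ⟨z + (1, 0), 1⟩ := by
    have := h3 ⟨z + (0, 1), 5⟩
    have e : (⟨z + (0, 1), 5⟩ : Kite) * r3 = ⟨z + (1, 0), 1⟩ := by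
      ext <;> simp [r3]; rfl
    rwa [e] at this
  have g1 (z) : c ⟨z, 0⟩ = a ⟨z, 1⟩ := e6 z 0
  have g2 (z) : c ⟨z, 1⟩ = a ⟨z, 2⟩ := e6 z 1
  have g3 (z) : c ⟨z, 2⟩ = a ⟨z, 3⟩ := e6 z 2
  have g4 (z) : c ⟨z, 3⟩ = a ⟨z, 4⟩ := e6 z 3
  have g5 (z) : c ⟨z, 4⟩ = a ⟨z, 5⟩ := e6 z 4
  have g6 (z) : c ⟨z, 5⟩ = a ⟨z, 0⟩ := e6 z 5
  have hz1 (z : ℤ × ℤ) : z + (1, 0) + (0, 1) = z + (1, 1) := by rw [add_assoc]; rfl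
  have hz2 (z : ℤ × ℤ) : z + (0, 1) + (1, 0) = z + (1, 1) := by rw [add_assoc]; rfl
  have closed (z) : u z + v (z + (1, 0)) = v z + u (z + (0, 1)) := by
    simp only [hu, hv, hz1, hz2]
    have F1 := f1 z; have F2 := f2 z; have F3 := f3 z
    have F4 := f4 z; have F5 := f5 z; have F6 := f6 z
    simp only [g1, g2, g3, g4, g5, g6] at F1 F2 F3 F4 F5 F6 ⊢
    rw [← sub_eq_zero] at F1 F2 F3 F4 F5 F6 ⊢
    refine Eq.trans ?_ (congrArg₂ (· + ·) (congrArg₂ (· + ·) (congrArg₂ (· + ·)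
      (congrArg₂ (· + ·) (congrArg₂ (· + ·) F1 F2) F3) F4) F5) F6 |>.trans (by simp))
    abel
  refine ⟨∑ i ∈ range N, u (i, ((0 : ℕ) : ℤ)), ∑ j ∈ range N, v (((0 : ℕ) : ℤ), j), fun x y => ?_⟩
  rw [← sum_shoelace x y (u := fun i j => u (i, j)) (v := fun i j => v (i, j))]
  · set w : Kite → ℤ := fun g => area x y (a g) (b g) (c g) with hw
    have hwp (k) : Periodic₂ N fun z => w ⟨z, k⟩ :=
      ((ha k).map₂ ((hb k).map₂ (hc k) Prod.mk) Prod.mk).comp fun p => area x y p.1 p.2.1 p.2.2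
    have hκ₀ : Periodic₂ N fun z => wedge x y (a ⟨z, 0⟩) (u z) := (ha 0).map₂ hup _
    have hκ₁ : Periodic₂ N fun z => wedge x y (a ⟨z, 1⟩) (v z) := (ha 1).map₂ hvp _
    have key (z : ℤ × ℤ) : w ⟨z, 0⟩ + w ⟨z + (1, 0), 1⟩ + w ⟨z + (1, 0), 2⟩ + w ⟨z + (1, 1), 3⟩ +
        w ⟨z + (0, 1), 4⟩ + w ⟨z + (0, 1), 5⟩ =
        wedge x y (u z + v (z + (1, 0))) (v z - u z) +
        (wedge x y (a ⟨z, 0⟩) (u z) - wedge x y (a ⟨z + (0, 1), 0⟩) (u (z + (0, 1)))) +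
        (wedge x y (a ⟨z + (1, 0), 1⟩) (v (z + (1, 0))) - wedge x y (a ⟨z, 1⟩) (v z)) := by
      have F1 := f1 z; have F2 := f2 z; have F3 := f3 z
      have F4 := f4 z; have F5 := f5 z; have F6 := f6 z
      simp only [hw, hu, hv, hz1, hz2]
      simp only [g1, g2, g3, g4, g5, g6] at F1 F2 F3 F4 F5 F6 ⊢
      exact six_kites x y F1 F2 F3 F4 F5 F6
    calc kiteSum N w = boxSum N fun z => w ⟨z, 0⟩ + w ⟨z + (1, 0), 1⟩ + w ⟨z + (1, 0), 2⟩ +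
          w ⟨z + (1, 1), 3⟩ + w ⟨z + (0, 1), 4⟩ + w ⟨z + (0, 1), 5⟩ := by
          rw [kiteSum_eq, sum_zmod6]
          simp only [boxSum_add]
          rw [boxSum_shift (hwp 1), boxSum_shift (hwp 2), boxSum_shift (hwp 3),
            boxSum_shift (hwp 4), boxSum_shift (hwp 5)]
      _ = boxSum N fun z => wedge x y (u z + v (z + (1, 0))) (v z - u z) := by
          simp only [key, boxSum_add, boxSum_sub]
          rw [boxSum_shift hκ₀, boxSum_shift hκ₁]
          simp
      _ = _ := by
          simp [boxSum]
  · intro i j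
    simpa using closed (i, j)
  · intro i
    simpa using (hup (i, 0)).2
  · intro j
    simpa using (hvp (0, j)).1

end Hat

namespace Hat

open Finset

/-- The index of the identity kite in a tile. -/
def root (t : Bool) : Fin 8 := match t with
  | false => 0
  | true => 2

theorem tile_root (t : Bool) : tile t (root t) = 1 := by
  cases t <;> rfl

theorem Consistent.mul_tile_iff {f : Kite → Bool × Fin 8} (hf : Consistent f) (h : Kite) (t : Bool)
    (i : Fin 8) : f (h * tile t i) = (t, i) ↔ f h = (t, root t) := by
  constructor
  · intro e
    have := hf (h * tile t i) (root t)
    rw [e] at this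
    simp only [tile_root, mul_one, mul_inv_cancel_right] at this
    exact this
  · intro e
    have := hf h i
    rw [e] at this
    simp only [tile_root, inv_one, one_mul] at this
    exact this

theorem kiteSum_sum {ι M : Type*} [AddCommMonoid M] (N : ℕ) (s : Finset ι) (F : ι → Kite → M) :
    kiteSum N (fun g => ∑ l ∈ s, F l g) = ∑ l ∈ s, kiteSum N (F l) := by
  simp only [kiteSum, boxSum]
  simp only [fun z : ℤ × ℤ => Finset.sum_comm (s := univ) (t := s) (f := fun k l => F l ⟨z, k⟩)]
  simp only [Finset.sum_comm (s := range N) (t := s)]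

/-- The number of tiles of a given kind and direction in an `N × N` box. -/
def count (f : Kite → Bool × Fin 8) (N : ℕ) (t : Bool) (k : ZMod 6) : ℤ :=
  boxSum N fun z => if f ⟨z, k⟩ = (t, root t) then 1 else 0

theorem count_nonneg (f : Kite → Bool × Fin 8) (N : ℕ) (t : Bool) (k : ZMod 6) :
    0 ≤ count f N t k := by
  rw [count, boxSum]
  refine Finset.sum_nonneg fun i _ => Finset.sum_nonneg fun j _ => ?_
  split_ifs <;> norm_num

theorem Consistent.kiteSum_label {f : Kite → Bool × Fin 8} (hf : Consistent f) {N : ℕ}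
    (hN : KitePeriodic N f) (W : Bool × Fin 8 → ZMod 6 → ℤ) :
    kiteSum N (fun g => W (f g) g.dir) =
      ∑ t, ∑ k, count f N t k * ∑ i, W (t, i) (k + (tile t i).dir) := by
  have h1 (g : Kite) : W (f g) g.dir =
      ∑ l : Bool × Fin 8, if f g = l then W l g.dir else 0 := by simp
  have h2 (t : Bool) (i : Fin 8) : kiteSum N (fun g => if f g = (t, i) then W (t, i) g.dir else 0) =
      ∑ k, count f N t k * W (t, i) (k + (tile t i).dir) := by
    rw [← kiteSum_mul_right (s := tile t i), kiteSum_eq]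
    · refine Finset.sum_congr rfl fun k _ => ?_
      simp only [hf.mul_tile_iff, Frame.mul_dir, count, boxSum, Finset.sum_mul, ite_mul, one_mul,
        zero_mul]
    · exact fun k => (hN k).comp fun l => if l = (t, i) then W (t, i) k else 0
  simp only [h1, kiteSum_sum, Fintype.sum_prod_type, h2, Finset.mul_sum]
  exact Finset.sum_congr rfl fun t _ => Finset.sum_comm

/-- The coordinates of a displacement. -/
def coord (i : Fin 5) : Pot →+ ℤ :=
  match i with
  | 0 => (AddMonoidHom.fst ℤ ℤ).comp (AddMonoidHom.fst _ _)
  | 1 => (AddMonoidHom.snd ℤ ℤ).comp (AddMonoidHom.fst _ _)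
  | 2 => (AddMonoidHom.fst ℤ ℤ).comp ((AddMonoidHom.fst _ ℤ).comp (AddMonoidHom.snd (ℤ × ℤ) _))
  | 3 => (AddMonoidHom.snd ℤ ℤ).comp ((AddMonoidHom.fst _ ℤ).comp (AddMonoidHom.snd (ℤ × ℤ) _))
  | 4 => (AddMonoidHom.snd _ _).comp (AddMonoidHom.snd _ _)

/-- The contribution of a kite to the formal area in coordinates `i, j`. -/
def kiteArea (i j : Fin 5) (l : Bool × Fin 8) (k : ZMod 6) : ℤ :=
  area (coord i) (coord j) (rot k (pot l).a) (rot k (pot l).b) (rot k (pot l).c)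

/-- The formal area of a tile in coordinates `i, j`. -/
def tileArea (i j : Fin 5) (t : Bool) (k : ZMod 6) : ℤ :=
  ∑ m, kiteArea i j (t, m) (k + (tile t m).dir)

/-- Twice the first coordinate of the direction of a tile, up to trace zero. -/
def dirX (k : ZMod 6) : ℤ := if k = 0 ∨ k = 3 then 2 else -1
/-- Twice the second coordinate of the direction of a tile, up to trace zero. -/
def dirY (k : ZMod 6) : ℤ := if k = 2 ∨ k = 5 then 2 else -1

theorem tileArea_eq : ∀ t k, tileArea 0 1 t k = 8 ∧ tileArea 2 3 t k = 4 ∧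
    tileArea 2 4 t k = 0 ∧ tileArea 3 4 t k = 0 ∧ tileArea 0 4 t k = 2 * dirX k ∧
    tileArea 1 4 t k = 2 * dirY k ∧ tileArea 0 3 t k = 4 + 2 * dirX k ∧
    tileArea 0 2 t k = (if t then -8 else 4) + 2 * dirY k ∧
    tileArea 1 2 t k = (if t then 4 else -8) + 2 * dirX k ∧
    tileArea 1 3 t k = (if t then -8 else 4) - 2 * (dirX k + dirY k) := by
  decide +kernel

theorem Consistent.sum_tileArea {f : Kite → Bool × Fin 8} (hf : Consistent f) {N : ℕ}
    (hN : KitePeriodic N f) : ∃ P Q : Pot, ∀ i j,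
      ∑ t, ∑ k, count f N t k * tileArea i j t k = 2 * wedge (coord i) (coord j) P Q := by
  obtain ⟨P, Q, h⟩ := sum_area (N := N) (a := fun g => rot g.dir (pot (f g)).a)
    (b := fun g => rot g.dir (pot (f g)).b) (c := fun g => rot g.dir (pot (f g)).c)
    (fun k => (hN k).comp fun l => rot k (pot l).a)
    (fun k => (hN k).comp fun l => rot k (pot l).b)
    (fun k => (hN k).comp fun l => rot k (pot l).c)
    (fun g => by rw [hf.pot_r6, HexModule.rot_rot]; rfl)
    (fun g => by
      rw [← HexModule.rot_sub, ← HexModule.rot_sub, hf.pot_r3, HexModule.rot_rot]; rfl)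
  exact ⟨P, Q, fun i j => by rw [← h]; exact (hf.kiteSum_label hN (kiteArea i j)).symm⟩

theorem eq_zero_of_form_eq_zero {p q : ℤ} (h : p ^ 2 - 7 * p * q + q ^ 2 = 0) : q = 0 := by
  by_contra hq
  have h5 : Irrational (√5) := Nat.Prime.irrational_sqrt (by norm_num : Nat.Prime 5)
  have h1 : ((2 * p - 7 * q : ℤ) : ℝ) ^ 2 = (3 * q * √5) ^ 2 := by
    rw [mul_pow, Real.sq_sqrt (by norm_num)]
    have : (2 * p - 7 * q) ^ 2 = (3 * q) ^ 2 * 5 := by linear_combination 4 * h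
    exact_mod_cast this
  have h2 : Irrational ((3 * q : ℤ) * √5) := h5.intCast_mul (by omega)
  push_cast at h2
  rcases sq_eq_sq_iff_eq_or_eq_neg.1 h1 with h | h
  · exact h2 ⟨(2 * p - 7 * q : ℤ), by rw [← h]; push_cast; rfl⟩
  · exact h2 ⟨-(2 * p - 7 * q : ℤ), by rw [← neg_eq_iff_eq_neg.2 h]; push_cast; rfl⟩

theorem Consistent.not_kitePeriodic {f : Kite → Bool × Fin 8} (hf : Consistent f) {N : ℕ}
    (hN0 : N ≠ 0) : ¬ KitePeriodic N f := by
  intro hN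
  obtain ⟨P, Q, h⟩ := hf.sum_tileArea hN
  set p := ∑ k, count f N false k with hp
  set q := ∑ k, count f N true k with hq
  set X := ∑ t, ∑ k, count f N t k * dirX k with hX
  set Y := ∑ t, ∑ k, count f N t k * dirY k with hY
  have hp0 : 0 ≤ p := Finset.sum_nonneg fun k _ => count_nonneg _ _ _ _
  have hq0 : 0 ≤ q := Finset.sum_nonneg fun k _ => count_nonneg _ _ _ _
  have hpq : 0 < p + q := by
    have := hf.kiteSum_label hN fun _ _ => 1
    simp only [kiteSum, boxSum, Fintype.sum_bool, Finset.sum_const, Finset.card_univ,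
      Fintype.card_fin, ZMod.card, ← Finset.sum_mul, Finset.card_range, ← hp, ← hq] at this
    have h2 : 0 < (N : ℤ) := by positivity
    have h3 : 0 < (N : ℤ) * N := by positivity
    simp only [nsmul_eq_mul] at this
    push_cast at this
    nlinarith
  have key (a b c : ℤ) (i j : Fin 5) (x : Bool → ℤ)
      (hx : ∀ t k, tileArea i j t k = x t + a * dirX k + b * dirY k) :
      x false * p + x true * q + a * X + b * Y = 2 * wedge (coord i) (coord j) P Q := by
    rw [← h, hp, hq, hX, hY]
    simp only [hx, Fintype.sum_bool, sum_zmod6]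
    ring
  have h01 := key 0 0 0 0 1 (fun _ => 8) fun t k => by
    obtain ⟨h, -⟩ := tileArea_eq t k; rw [h]; ring
  have h23 := key 0 0 0 2 3 (fun _ => 4) fun t k => by
    obtain ⟨-, h, -⟩ := tileArea_eq t k; rw [h]; ring
  have h24 := key 0 0 0 2 4 (fun _ => 0) fun t k => by
    obtain ⟨-, -, h, -⟩ := tileArea_eq t k; rw [h]; ring
  have h34 := key 0 0 0 3 4 (fun _ => 0) fun t k => by
    obtain ⟨-, -, -, h, -⟩ := tileArea_eq t k; rw [h]; ring
  have h04 := key 2 0 0 0 4 (fun _ => 0) fun t k => by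
    obtain ⟨-, -, -, -, h, -⟩ := tileArea_eq t k; rw [h]; ring
  have h14 := key 0 2 0 1 4 (fun _ => 0) fun t k => by
    obtain ⟨-, -, -, -, -, h, -⟩ := tileArea_eq t k; rw [h]; ring
  have h03 := key 2 0 0 0 3 (fun _ => 4) fun t k => by
    obtain ⟨-, -, -, -, -, -, h, -⟩ := tileArea_eq t k; rw [h]; ring
  have h02 := key 0 2 0 0 2 (fun t => if t then -8 else 4) fun t k => by
    obtain ⟨-, -, -, -, -, -, -, h, -⟩ := tileArea_eq t k; rw [h]; ring
  have h12 := key 2 0 0 1 2 (fun t => if t then 4 else -8) fun t k => by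
    obtain ⟨-, -, -, -, -, -, -, -, h, -⟩ := tileArea_eq t k; rw [h]; ring
  have h13 := key (-2) (-2) 0 1 3 (fun t => if t then -8 else 4) fun t k => by
    obtain ⟨-, -, -, -, -, -, -, -, -, h⟩ := tileArea_eq t k; rw [h]; ring
  have plücker (i j k l : Fin 5) :
      wedge (coord i) (coord j) P Q * wedge (coord k) (coord l) P Q -
      wedge (coord i) (coord k) P Q * wedge (coord j) (coord l) P Q +
      wedge (coord i) (coord l) P Q * wedge (coord j) (coord k) P Q = 0 := by
    simp only [wedge]; ring
  have p1 := plücker 0 2 3 4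
  have p2 := plücker 1 2 3 4
  have p3 := plücker 0 1 2 3
  generalize wedge (coord 0) (coord 1) P Q = w01 at *
  generalize wedge (coord 0) (coord 2) P Q = w02 at *
  generalize wedge (coord 0) (coord 3) P Q = w03 at *
  generalize wedge (coord 0) (coord 4) P Q = w04 at *
  generalize wedge (coord 1) (coord 2) P Q = w12 at *
  generalize wedge (coord 1) (coord 3) P Q = w13 at *
  generalize wedge (coord 1) (coord 4) P Q = w14 at *
  generalize wedge (coord 2) (coord 3) P Q = w23 at *
  generalize wedge (coord 2) (coord 4) P Q = w24 at *
  generalize wedge (coord 3) (coord 4) P Q = w34 at *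
  simp only [if_true, if_false, Bool.false_eq_true] at *
  obtain rfl : w01 = 4 * (p + q) := by linarith
  obtain rfl : w23 = 2 * (p + q) := by linarith
  obtain rfl : w24 = 0 := by linarith
  obtain rfl : w34 = 0 := by linarith
  obtain rfl : w04 = 0 := by
    have : w04 * (p + q) = 0 := by linarith
    exact (mul_eq_zero.1 this).resolve_right hpq.ne'
  obtain rfl : w14 = 0 := by
    have : w14 * (p + q) = 0 := by linarith
    exact (mul_eq_zero.1 this).resolve_right hpq.ne'
  obtain rfl : w03 = 2 * (p + q) := by linarith
  obtain rfl : w02 = 2 * p - 4 * q := by linarith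
  obtain rfl : w12 = -4 * p + 2 * q := by linarith
  obtain rfl : w13 = 2 * p - 4 * q := by linarith
  have e1 := eq_zero_of_form_eq_zero (p := p) (q := q) (by linarith)
  have e2 := eq_zero_of_form_eq_zero (p := q) (q := p) (by linarith)
  omega

end Hat

namespace Hat

/-! ### From one period to two -/

/-- The periods of a function. -/
def periods {X : Type*} (F : ℤ × ℤ → X) : AddSubgroup (ℤ × ℤ) where
  carrier := {v | ∀ z, F (z + v) = F z}
  zero_mem' z := by rw [add_zero]
  add_mem' {v w} hv hw z := by rw [← add_assoc, hw, hv]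
  neg_mem' {v} hv z := by rw [← hv, neg_add_cancel_right]

theorem mem_periods {X : Type*} {F : ℤ × ℤ → X} {v : ℤ × ℤ} :
    v ∈ periods F ↔ ∀ z, F (z + v) = F z := Iff.rfl

theorem ediv_add_eq {x y m : ℤ} (hm : |y| ≤ m) (h0 : 0 < m) :
    (x + y) / m = x / m ∨ ((x + y) / m = x / m + 1 ∧ m ≤ x % m + y) ∨
      ((x + y) / m = x / m - 1 ∧ x % m + y < 0) := by
  have h1 := Int.emod_nonneg x h0.ne'
  have h2 := Int.emod_lt_of_pos x h0
  have h3 : (x + y) / m = x / m + (x % m + y) / m := by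
    conv_lhs => rw [← Int.emod_add_mul_ediv x m, add_right_comm]
    rw [Int.add_mul_ediv_left _ _ h0.ne', add_comm]
  obtain ⟨h4, h5⟩ := abs_le.1 hm
  rw [h3]
  rcases lt_or_ge (x % m + y) 0 with h | h
  · have : (x % m + y) / m = -1 := by
      rw [Int.ediv_eq_iff_of_pos h0]; constructor <;> linarith
    right; right; rw [this]; exact ⟨rfl, h⟩
  · rcases lt_or_ge (x % m + y) m with h6 | h6
    · left; rw [Int.ediv_eq_zero_of_lt h h6, add_zero]
    · have : (x % m + y) / m = 1 := by
        rw [Int.ediv_eq_iff_of_pos h0]; constructor <;> linarith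
      right; left; rw [this]; exact ⟨rfl, h6⟩

/-- A colouring of `ℤ²` with one period can be replaced by a colouring with two periods that has
the same patterns of bounded size. -/
theorem exists_periodic₂ {X : Type*} [Finite X] {F : ℤ × ℤ → X} {p : ℤ × ℤ} (hp0 : p ≠ 0)
    (hp : p ∈ periods F) (W : ℤ) :
    ∃ F' : ℤ × ℤ → X, ∃ N : ℕ, N ≠ 0 ∧ Periodic₂ N F' ∧
      ∀ z, ∃ s, ∀ d : ℤ × ℤ, |d.1| ≤ W → |d.2| ≤ W → F' (z + d) = F (s + d) := by
  obtain ⟨a, b⟩ := p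
  set n := a * a + b * b with hn
  have hn0 : 0 < n := by
    have : a ≠ 0 ∨ b ≠ 0 := by
      by_contra! h
      exact hp0 (by rw [h.1, h.2]; rfl)
    rcases this with h | h
    · have := mul_self_pos.2 h; have := mul_self_nonneg b; omega
    · have := mul_self_pos.2 h; have := mul_self_nonneg a; omega
  set L := (|a| + |b|) * |W| + 1 with hL
  have hL0 : 0 < L := by positivity
  set B := (|a| + |b|) * (n + L) with hB
  let ℓ (z : ℤ × ℤ) : ℤ := a * z.2 - b * z.1
  have hℓ_add (z w : ℤ × ℤ) : ℓ (z + w) = ℓ z + ℓ w := by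
    simp only [ℓ, Prod.fst_add, Prod.snd_add]; ring
  have hℓd (d : ℤ × ℤ) (h1 : |d.1| ≤ W) (h2 : |d.2| ≤ W) : |ℓ d| ≤ L := by
    have hW : |W| = W := abs_of_nonneg ((abs_nonneg _).trans h1)
    calc |ℓ d| ≤ |a * d.2| + |b * d.1| := abs_sub _ _
      _ = |a| * |d.2| + |b| * |d.1| := by rw [abs_mul, abs_mul]
      _ ≤ |a| * W + |b| * W := by gcongr
      _ ≤ L := by rw [hL, hW]; linarith
  let box := Finset.Icc ((-B, -B) : ℤ × ℤ) (B, B)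
  let μ : ℤ × ℤ := (-b * L, a * L)
  obtain ⟨t₁, t₂, hne, heq⟩ := Finite.exists_ne_map_eq_of_infinite
    fun (t : ℕ) (v : box) => F ((t : ℤ) • μ + v)
  wlog hlt : t₁ < t₂ generalizing t₁ t₂
  · exact this t₂ t₁ hne.symm heq.symm (by omega)
  have heq (v : ℤ × ℤ) (hv : |ℓ v| ≤ L) : F ((t₁ : ℤ) • μ + v) = F ((t₂ : ℤ) • μ + v) := by
    set s := (v.1 * a + v.2 * b) / n with hs
    have hs0 := Int.emod_nonneg (v.1 * a + v.2 * b) hn0.ne'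
    have hs1 := Int.emod_lt_of_pos (v.1 * a + v.2 * b) hn0
    have hs2 := Int.emod_add_mul_ediv (v.1 * a + v.2 * b) n
    rw [← hs] at hs2
    set r := (v.1 * a + v.2 * b) % n
    have h (w : ℤ × ℤ) : F (w + v) = F (w + (v + (-s) • (a, b))) := by
      rw [← add_assoc]
      exact (mem_periods.1 (AddSubgroup.zsmul_mem _ hp _) _).symm
    rw [h, h]
    have hr : |r| ≤ n := by rw [abs_of_nonneg hs0]; exact hs1.le
    have bound (u x y : ℤ) (hx : |x| ≤ |a| + |b|) (hy : |y| ≤ |a| + |b|)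
        (hu : n * u = r * x + ℓ v * y) : -B ≤ u ∧ u ≤ B := by
      rw [← abs_le]
      calc |u| ≤ n * |u| := le_mul_of_one_le_left (abs_nonneg _) hn0
        _ = |r * x + ℓ v * y| := by rw [← hu, abs_mul, abs_of_pos hn0]
        _ ≤ |r| * |x| + |ℓ v| * |y| := by rw [← abs_mul, ← abs_mul]; exact abs_add_le _ _
        _ ≤ n * (|a| + |b|) + L * (|a| + |b|) := by gcongr
        _ = B := by rw [hB]; ring
    have h1 := bound (v.1 - s * a) a (-b) (by linarith [abs_nonneg b])
      (by rw [abs_neg]; linarith [abs_nonneg a]) (by simp only [ℓ]; linear_combination (-a) * hs2)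
    have h2 := bound (v.2 - s * b) b a (by linarith [abs_nonneg a]) (by linarith [abs_nonneg b])
      (by simp only [ℓ]; linear_combination (-b) * hs2)
    refine congrFun heq ⟨_, ?_⟩
    simp only [box, Finset.mem_Icc, Prod.le_def, Prod.fst_add, Prod.snd_add, Prod.smul_fst,
      Prod.smul_snd, smul_eq_mul]
    refine ⟨⟨?_, ?_⟩, ?_, ?_⟩ <;> linarith [h1.1, h1.2, h2.1, h2.2]
  set T : ℤ := (t₂ : ℤ) - t₁ with hT
  have hT0 : 0 < T := by omega
  set Q : ℤ × ℤ := T • μ with hQ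
  have ht₂ : (t₂ : ℤ) • μ = (t₁ : ℤ) • μ + Q := by rw [hQ, ← add_smul]; congr 1; omega
  set m := T * L * n with hm
  have hm0 : 0 < m := by positivity
  have hLm : L ≤ m := by
    have h1 : 1 ≤ T * n := mul_pos hT0 hn0
    have := mul_le_mul_of_nonneg_left h1 hL0.le
    linarith [mul_comm L (T * n), mul_right_comm T n L]
  have hℓQ : ℓ Q = m := by simp [ℓ, hQ, μ, hm, hn]; ring
  have hℓp : ℓ (a, b) = 0 := by simp only [ℓ]; ring
  have hℓj (j : ℤ) : ℓ (j • Q) = j * m := by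
    rw [← hℓQ]; simp only [ℓ, Prod.smul_fst, Prod.smul_snd, smul_eq_mul]; ring
  let F' (z : ℤ × ℤ) : X := F ((t₁ : ℤ) • μ + (z - (ℓ z / m) • Q))
  have hpF' : (a, b) ∈ periods F' := fun z => by
    simp only [F', hℓ_add, hℓp, add_zero]
    rw [add_sub_right_comm, ← add_assoc]
    exact hp _
  have hQF' : Q ∈ periods F' := fun z => by
    simp only [F', hℓ_add, hℓQ]
    rw [show ℓ z + m = ℓ z + 1 * m by ring, Int.add_mul_ediv_right _ _ hm0.ne', add_smul, one_smul,
      add_sub_add_right_eq_sub]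
  refine ⟨F', m.toNat, by omega, fun z => ?_, fun z => ⟨(t₁ : ℤ) • μ + (z - (ℓ z / m) • Q), ?_⟩⟩
  · rw [Int.toNat_of_nonneg hm0.le]
    have h1 : ((m, 0) : ℤ × ℤ) = (T * L * a) • (a, b) + (-b) • Q := by
      ext <;> simp [hm, hn, hQ, μ] <;> ring
    have h2 : ((0, m) : ℤ × ℤ) = (T * L * b) • (a, b) + a • Q := by
      ext <;> simp [hm, hn, hQ, μ] <;> ring
    rw [h1, h2]
    exact ⟨add_mem (AddSubgroup.zsmul_mem _ hpF' _) (AddSubgroup.zsmul_mem _ hQF' _) z,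
      add_mem (AddSubgroup.zsmul_mem _ hpF' _) (AddSubgroup.zsmul_mem _ hQF' _) z⟩
  · intro d hd1 hd2
    have hd := hℓd d hd1 hd2
    have hz := Int.emod_add_mul_ediv (ℓ z) m
    have hz0 := Int.emod_nonneg (ℓ z) hm0.ne'
    have hz1 := Int.emod_lt_of_pos (ℓ z) hm0
    obtain ⟨hd3, hd4⟩ := abs_le.1 hd
    simp only [F', hℓ_add]
    rcases ediv_add_eq (x := ℓ z) (hd.trans hLm) hm0 with h | ⟨h, h'⟩ | ⟨h, h'⟩
    · rw [h]; congr 1; abel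
    · rw [h, heq, ht₂]
      · congr 1; rw [add_smul, one_smul]; abel
      · rw [sub_eq_add_neg, ← neg_smul, hℓ_add, hℓj, hℓ_add, abs_le]
        constructor <;> linarith [mul_comm m (ℓ z / m)]
    · rw [h, show z + d - (ℓ z / m - 1) • Q = Q + (z - (ℓ z / m) • Q + d) by
        rw [sub_smul, one_smul]; abel, ← add_assoc, ← ht₂, ← heq, add_assoc]
      rw [sub_eq_add_neg, ← neg_smul, hℓ_add, hℓ_add, hℓj, abs_le]
      constructor <;> linarith [mul_comm m (ℓ z / m)]

theorem Consistent.not_periodic {f : Kite → Bool × Fin 8} (hf : Consistent f) {p : ℤ × ℤ}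
    (hp0 : p ≠ 0) (hp : ∀ z k, f ⟨z + p, k⟩ = f ⟨z, k⟩) : False := by
  obtain ⟨F, N, hN, hFN, hF⟩ := exists_periodic₂ (F := fun z k => f ⟨z, k⟩) hp0
    (fun z => funext fun k => hp z k) 6
  refine Consistent.not_kitePeriodic (f := fun g => F g.pos g.dir) (fun g i => ?_) hN
    fun k z => ⟨congrFun (hFN z).1 k, congrFun (hFN z).2 k⟩
  obtain ⟨z, k⟩ := g
  obtain ⟨s, hs⟩ := hF z
  have h0 := congrFun (hs 0 (by decide) (by decide)) k
  rw [add_zero, add_zero] at h0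
  have hbound : ∀ (k : ZMod 6) t i j, |(rot k ((tile t i)⁻¹ * tile t j).pos).1| ≤ 6 ∧
    |(rot k ((tile t i)⁻¹ * tile t j).pos).2| ≤ 6 := by decide +kernel
  have h1 := hf ⟨s, k⟩ i
  have hb := hbound k (f ⟨s, k⟩).1 (f ⟨s, k⟩).2 i
  rw [← h0] at h1 hb
  have h2 := congrFun (hs _ hb.1 hb.2) (k + ((tile (F z k).1 (F z k).2)⁻¹ * tile (F z k).1 i).dir)
  exact h2.trans h1

theorem IsTiling.exists_consistent {D : Set (Kite × Bool)} (hD : IsTiling D) :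
    ∃ f, Consistent f ∧ ∀ h ∈ symmetries D, ∀ g, f (h * g) = f g := by
  choose q hq hu using hD
  refine ⟨fun g => ((q g).1.2, (q g).2), fun g i => ?_, fun h hh g => ?_⟩
  · have h1 := hu (g * ((tile (q g).1.2 (q g).2)⁻¹ * tile (q g).1.2 i)) ((q g).1, i)
      ⟨(hq g).1, by
        conv_rhs => enter [1]; rw [← (hq g).2]
        simp only [mul_assoc, mul_inv_cancel_left]⟩
    simp only [← h1]
  · have h1 := hu (h * g) ((h * (q g).1.1, (q g).1.2), (q g).2)
      ⟨(hh _ _).2 (hq g).1, by rw [mul_assoc, (hq g).2]⟩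
    simp only [← h1]

theorem IsTiling.finite_symmetries {D : Set (Kite × Bool)} (hD : IsTiling D) :
    (symmetries D).Finite := by
  by_contra hinf
  obtain ⟨x, hx, y, hy, hne, hxy⟩ := Set.Infinite.exists_ne_map_eq_of_mapsTo hinf
    (f := Frame.dir) (t := Set.univ) (fun _ _ => Set.mem_univ _) Set.finite_univ
  obtain ⟨f, hf, hsym⟩ := hD.exists_consistent
  have hmem : x * y⁻¹ ∈ symmetries D := fun g t => by
    rw [mul_assoc, hx, ← hy, mul_inv_cancel_left]
  have hdir : (x * y⁻¹).dir = 0 := by simp [hxy]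
  rw [ne_eq, ← mul_inv_eq_one] at hne
  generalize x * y⁻¹ = w at *
  refine hf.not_periodic (p := w.pos) (fun h => hne (Frame.ext h hdir)) fun z k => ?_
  · rw [← hsym _ hmem ⟨z, k⟩]
    congr 1
    ext1
    · rw [Frame.mul_pos, hdir, HexModule.rot_zero, add_comm]
    · rw [Frame.mul_dir, hdir, zero_add]

end Hat

namespace Hat

/-! ### The substitution -/

/-- Positions of metatiles: the position in the current level and in the next one. -/
abbrev Phase := (ℤ × ℤ) × (ℤ × ℤ)

/-- Placements of metatiles. -/
abbrev Place := Frame Phase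

/-- Metatiles: a metatile of kind `false` consists of eight hats, one of kind `true` of seven. -/
abbrev Meta := Bool × Place

/-- The linear part of the substitution. -/
def inflate (v : Phase) : Phase := (v.2, (3 * v.2.1 - v.1.1, 3 * v.2.2 - v.1.2))

theorem inflate_add (v w : Phase) : inflate (v + w) = inflate v + inflate w := by
  ext <;> simp only [inflate, Prod.fst_add, Prod.snd_add] <;> ring

theorem inflate_neg (v : Phase) : inflate (-v) = -inflate v := by
  ext <;> simp only [inflate, Prod.fst_neg, Prod.snd_neg] <;> ring

theorem inflate_sub (v w : Phase) : inflate (v - w) = inflate v - inflate w := by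
  rw [sub_eq_add_neg, inflate_add, inflate_neg, ← sub_eq_add_neg]

theorem rot_phase (k : ZMod 6) (v : Phase) : rot k v = (rot k v.1, rot k v.2) := rfl

theorem inflate_rot (k : ZMod 6) (v : Phase) : inflate (rot k v) = rot k (inflate v) := by
  revert k
  rw [HexModule.forall_zmod6]
  simp only [rot_phase, inflate]
  refine ⟨?_, ?_, ?_, ?_, ?_, ?_⟩ <;> ext <;> simp <;> ring

/-- The action of the substitution on placements. -/
def inflatePlace (g : Place) : Place := ⟨inflate g.pos, g.dir⟩

theorem inflatePlace_mul (g h : Place) :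
    inflatePlace (g * h) = inflatePlace g * inflatePlace h := by
  ext1
  · simp only [inflatePlace, Frame.mul_pos, inflate_add, inflate_rot]
  · rfl

theorem inflatePlace_inv (g : Place) : inflatePlace g⁻¹ = (inflatePlace g)⁻¹ := by
  rw [eq_inv_iff_mul_eq_one, ← inflatePlace_mul, inv_mul_cancel]
  rfl

/-- Placements of the children of a metatile; the last one is missing if the kind is `true`. -/
def digit (c : Fin 7) : Place :=
  match c.val with
  | 0 => ⟨((0, 0), (0, 0)), 0⟩
  | 1 => ⟨((1, -4), (3, -11)), 4⟩
  | 2 => ⟨((-4, 3), (-11, 8)), 1⟩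
  | 3 => ⟨((-7, 2), (-19, 5)), 2⟩
  | 4 => ⟨((4, -3), (11, -8)), 5⟩
  | 5 => ⟨((-2, -1), (-5, -2)), 0⟩
  | _ => ⟨((3, 1), (8, 3)), 0⟩

/-- Indices of the children of a metatile. -/
def childIdx (i : Bool) : List (Fin 7) := if i then [0, 1, 2, 3, 4, 5] else [0, 1, 2, 3, 4, 5, 6]

/-- Kinds of the children of a metatile. -/
def childKind (c : Fin 7) : Bool := c = 5

/-- A child of a metatile. The substitution is normalized so as to fix the child of index `1` of
the metatile `(false, 1)`. -/
def child (τ : Meta) (c : Fin 7) : Meta :=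
  (childKind c, (digit 1)⁻¹ * inflatePlace τ.2 * digit c)

/-- The metatiles obtained by iterating the substitution. -/
def patch : ℕ → List Meta
  | 0 => [(false, 1)]
  | n + 1 => (patch n).flatMap fun τ => (childIdx τ.1).map (child τ)

theorem mem_patch_succ {n : ℕ} {τ : Meta} :
    τ ∈ patch (n + 1) ↔ ∃ σ ∈ patch n, ∃ c ∈ childIdx σ.1, child σ c = τ := by
  simp only [patch, List.mem_flatMap, List.mem_map]

theorem patch_subset_succ (n : ℕ) : ∀ τ ∈ patch n, τ ∈ patch (n + 1) := by
  induction n with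
  | zero => decide +kernel
  | succ n ih =>
    intro τ hτ
    obtain ⟨σ, hσ, h⟩ := mem_patch_succ.1 hτ
    exact mem_patch_succ.2 ⟨σ, ih σ hσ, h⟩

theorem patch_subset {m n : ℕ} (h : m ≤ n) : ∀ τ ∈ patch m, τ ∈ patch n := by
  induction h with
  | refl => exact fun _ h => h
  | step _ ih => exact fun τ hτ => patch_subset_succ _ _ (ih τ hτ)

/-- The hats in a metatile. -/
def hats (i : Bool) : List (Kite × Bool) :=
  [(⟨(-1, 0), 0⟩, true), (⟨(-2, 1), 3⟩, false), (⟨(-1, -1), 1⟩, false), (⟨(-1, 1), 2⟩, false),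
    (⟨(0, -1), 5⟩, false), (⟨(0, 0), 1⟩, false), (⟨(1, -1), 0⟩, false)] ++
  if i then [] else [(⟨(1, 0), 1⟩, false)]

/-- The eight kites of a placed hat. -/
def kites (q : Kite × Bool) : List Kite := (List.finRange 8).map fun l => q.1 * tile q.2 l

/-- The kites in a metatile. -/
def cells (i : Bool) : List Kite := (hats i).flatMap kites

theorem mem_cells {i : Bool} {x : Kite} :
    x ∈ cells i ↔ ∃ q ∈ hats i, ∃ l, q.1 * tile q.2 l = x := by
  simp [cells, kites]

/-- Positions of the kites with a given direction in a metatile. -/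
def cellPos (i : Bool) (k : ZMod 6) : List (ℤ × ℤ) :=
  match k.val with
  | 0 =>
    [(-1, 0), (-2, 0), (-1, -1), (-1, 1), (-2, 1), (0, -1), (1, -2), (0, 0), (1, -1)] ++
      if i then [] else [(1, 0)]
  | 1 =>
    [(-1, 0), (0, -1), (-2, 1), (-2, 0), (-1, -1), (-1, 1), (1, -2), (0, 0), (1, -1), (2, -1)] ++
      if i then [] else [(1, 0)]
  | 2 =>
    [(0, -1), (-2, 1), (-1, -1), (-1, 0), (-1, 1), (1, -1), (0, 0), (0, 1), (2, -1)] ++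
      if i then [] else [(1, 0), (1, 1)]
  | 3 =>
    [(0, 0), (-2, 1), (-1, 0), (-1, 1), (-2, 2), (0, -1), (1, -1), (0, 1), (1, 0)] ++
      if i then [] else [(1, 1)]
  | 4 =>
    [(-1, 0), (0, 0), (-2, 1), (-3, 1), (-2, 0), (-2, 2), (0, -1), (-1, 1), (1, -1), (1, 0)] ++
      if i then [] else [(0, 1)]
  | _ =>
    [(-1, 0), (-3, 1), (-1, -1), (-2, 0), (-2, 1), (0, -1), (0, 0), (-1, 1), (1, -1)] ++
      if i then [] else [(1, 0), (0, 1)]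

theorem mem_cells_of_mem_cellPos : ∀ i k, ∀ p ∈ cellPos i k, (⟨p, k⟩ : Kite) ∈ cells i := by
  decide +kernel

theorem pos_mem_cellPos : ∀ i, ∀ x ∈ cells i, x.pos ∈ cellPos i x.dir := by
  decide +kernel

/-- The Kitegrid placement of a metatile. -/
def proj : Place →* Kite where
  toFun g := ⟨g.pos.1, g.dir⟩
  map_one' := rfl
  map_mul' _ _ := rfl

/-- The placements of hats in the limit of the substitution. -/
def hatPlacements : Set (Kite × Bool) :=
  {q | ∃ n, ∃ τ ∈ patch n, ∃ r ∈ hats τ.1, (proj τ.2 * r.1, r.2) = q}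

/-! ### Every kite is covered -/

/-- The neighbourhoods of metatiles: the metatile of the given kind placed at the identity is
surrounded by the listed metatiles. -/
def coronas : List (Bool × List Meta) :=
  [
    (false, [
      (false, ⟨((-3, -1), (-8, -3)), 0⟩), (false, ⟨((3, -2), (7, -5)), 1⟩),
      (false, ⟨((-2, 4), (-6, 10)), 2⟩), (false, ⟨((-4, 2), (-10, 4)), 4⟩),
      (false, ⟨((1, -4), (3, -11)), 5⟩), (true, ⟨((3, 1), (8, 3)), 0⟩)]),
    (false, [
      (false, ⟨((-3, -1), (-8, -3)), 0⟩), (false, ⟨((-2, 4), (-6, 10)), 2⟩),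
      (false, ⟨((2, 1), (5, 2)), 2⟩), (false, ⟨((3, -3), (8, -9)), 3⟩),
      (false, ⟨((-4, 2), (-10, 4)), 4⟩), (false, ⟨((1, -4), (3, -11)), 5⟩)]),
    (false, [
      (false, ⟨((-3, -1), (-8, -3)), 0⟩), (false, ⟨((3, -3), (8, -9)), 3⟩),
      (false, ⟨((-4, 2), (-10, 4)), 4⟩), (false, ⟨((-1, 3), (-2, 7)), 5⟩),
      (false, ⟨((1, -4), (3, -11)), 5⟩), (true, ⟨((3, 0), (9, -1)), 5⟩)]),
    (false, [
      (false, ⟨((3, 1), (8, 3)), 0⟩), (false, ⟨((-4, 3), (-11, 8)), 1⟩),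
      (false, ⟨((-1, 3), (-2, 7)), 4⟩), (false, ⟨((1, -4), (3, -11)), 4⟩),
      (false, ⟨((4, -3), (11, -8)), 5⟩), (true, ⟨((-2, -1), (-5, -2)), 0⟩)]),
    (false, [
      (false, ⟨((-4, 3), (-11, 8)), 1⟩), (false, ⟨((-3, -1), (-8, -3)), 1⟩),
      (false, ⟨((3, -2), (7, -5)), 1⟩), (false, ⟨((-2, 4), (-6, 10)), 2⟩),
      (false, ⟨((1, -4), (3, -11)), 5⟩), (true, ⟨((3, 1), (8, 3)), 0⟩)]),
    (false, [
      (false, ⟨((-4, 3), (-11, 8)), 1⟩), (false, ⟨((-3, -1), (-8, -3)), 1⟩),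
      (false, ⟨((-2, 4), (-6, 10)), 2⟩), (false, ⟨((2, 1), (5, 2)), 2⟩),
      (false, ⟨((3, -3), (8, -9)), 3⟩), (false, ⟨((1, -4), (3, -11)), 5⟩)]),
    (false, [
      (false, ⟨((-4, 3), (-11, 8)), 1⟩), (false, ⟨((-3, -1), (-8, -3)), 1⟩),
      (false, ⟨((2, 1), (5, 2)), 2⟩), (false, ⟨((3, -3), (8, -9)), 3⟩),
      (false, ⟨((-1, 3), (-2, 7)), 4⟩), (false, ⟨((1, -4), (3, -11)), 5⟩)]),
    (false, [
      (false, ⟨((-4, 3), (-11, 8)), 1⟩), (false, ⟨((3, -2), (7, -5)), 1⟩),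
      (false, ⟨((-3, -1), (-8, -3)), 2⟩), (false, ⟨((-2, 4), (-6, 10)), 2⟩),
      (true, ⟨((3, 1), (8, 3)), 0⟩), (true, ⟨((0, -3), (-1, -8)), 2⟩)]),
    (false, [
      (false, ⟨((-4, 3), (-11, 8)), 1⟩), (false, ⟨((3, -2), (7, -5)), 1⟩),
      (false, ⟨((-2, 4), (-6, 10)), 2⟩), (false, ⟨((1, -4), (3, -11)), 5⟩),
      (true, ⟨((3, 1), (8, 3)), 0⟩), (true, ⟨((-2, -2), (-4, -6)), 5⟩)]),
    (false, [
      (false, ⟨((-4, 3), (-11, 8)), 1⟩), (false, ⟨((-3, -1), (-8, -3)), 2⟩),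
      (false, ⟨((2, 1), (5, 2)), 2⟩), (false, ⟨((3, -3), (8, -9)), 3⟩),
      (false, ⟨((-1, 3), (-2, 7)), 4⟩), (true, ⟨((0, -3), (-1, -8)), 2⟩)]),
    (false, [
      (false, ⟨((-4, 3), (-11, 8)), 1⟩), (false, ⟨((-2, 4), (-6, 10)), 2⟩),
      (false, ⟨((1, -4), (3, -11)), 4⟩), (false, ⟨((4, -3), (11, -8)), 5⟩),
      (true, ⟨((-2, -1), (-5, -2)), 0⟩), (true, ⟨((3, 1), (8, 3)), 0⟩)]),
    (false, [
      (false, ⟨((-4, 3), (-11, 8)), 1⟩), (false, ⟨((2, 1), (5, 2)), 2⟩),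
      (false, ⟨((3, -3), (8, -9)), 3⟩), (false, ⟨((-1, 3), (-2, 7)), 4⟩),
      (false, ⟨((1, -4), (3, -11)), 5⟩), (true, ⟨((-2, -2), (-4, -6)), 5⟩)]),
    (false, [
      (false, ⟨((-3, -1), (-8, -3)), 1⟩), (false, ⟨((3, -3), (8, -9)), 3⟩),
      (false, ⟨((-1, 3), (-2, 7)), 5⟩), (false, ⟨((1, -4), (3, -11)), 5⟩),
      (true, ⟨((-4, 3), (-11, 8)), 1⟩), (true, ⟨((3, 0), (9, -1)), 5⟩)]),
    (false, [
      (false, ⟨((3, -2), (7, -5)), 1⟩), (false, ⟨((-2, 4), (-6, 10)), 2⟩),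
      (false, ⟨((-4, 2), (-10, 4)), 4⟩), (false, ⟨((1, -4), (3, -11)), 5⟩),
      (true, ⟨((3, 1), (8, 3)), 0⟩), (true, ⟨((-3, -2), (-7, -7)), 4⟩)]),
    (false, [
      (false, ⟨((-2, 4), (-6, 10)), 2⟩), (false, ⟨((2, 1), (5, 2)), 2⟩),
      (false, ⟨((3, -3), (8, -9)), 3⟩), (false, ⟨((-4, 2), (-10, 4)), 4⟩),
      (false, ⟨((1, -4), (3, -11)), 5⟩), (true, ⟨((-3, -2), (-7, -7)), 4⟩)]),
    (false, [
      (false, ⟨((3, -3), (8, -9)), 3⟩), (false, ⟨((-4, 2), (-10, 4)), 4⟩),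
      (false, ⟨((-1, 3), (-2, 7)), 5⟩), (false, ⟨((1, -4), (3, -11)), 5⟩),
      (true, ⟨((-3, -2), (-7, -7)), 4⟩), (true, ⟨((3, 0), (9, -1)), 5⟩)]),
    (true, [
      (false, ⟨((-3, -1), (-8, -3)), 0⟩), (false, ⟨((2, 1), (5, 2)), 0⟩),
      (false, ⟨((-2, 4), (-6, 10)), 1⟩), (false, ⟨((0, -3), (-1, -8)), 1⟩),
      (false, ⟨((-5, 3), (-14, 7)), 2⟩), (false, ⟨((3, -3), (8, -9)), 4⟩)]),
    (true, [
      (false, ⟨((-3, -1), (-8, -3)), 0⟩), (false, ⟨((2, 1), (5, 2)), 0⟩),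
      (false, ⟨((-2, 4), (-6, 10)), 1⟩), (false, ⟨((-5, 3), (-14, 7)), 2⟩),
      (false, ⟨((3, -3), (8, -9)), 4⟩), (false, ⟨((1, -4), (3, -11)), 5⟩)])]

theorem corona_patch : ∃ Z ∈ coronas, Z.1 = false ∧ ∀ z ∈ Z.2, z ∈ patch 3 := by
  decide +kernel

theorem corona_child : ∀ Z ∈ coronas, ∀ c ∈ childIdx Z.1, ∃ Z' ∈ coronas, Z'.1 = childKind c ∧
    ∀ z' ∈ Z'.2, ∃ z ∈ (Z.1, 1) :: Z.2, ∃ c' ∈ childIdx z.1, childKind c' = z'.1 ∧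
      (digit c)⁻¹ * inflatePlace z.2 * digit c' = z'.2 := by
  decide +kernel

theorem corona_cells : ∀ Z ∈ coronas, ∀ s ∈ [r6, r3], ∀ x ∈ cells Z.1,
    ∃ z ∈ (Z.1, 1) :: Z.2,
      ((proj z.2)⁻¹ * (x * s)).pos ∈ cellPos z.1 ((proj z.2)⁻¹ * (x * s)).dir := by
  decide +kernel

end Hat

namespace Hat

/-! ### Metatiles do not overlap -/

/-- The relative positions of close pairs of metatiles. -/
def relations : List (Bool × Meta) :=
  [(false, false, ⟨((-5, 6), (-13, 15)), 0⟩), (false, false, ⟨((-3, -1), (-8, -3)), 0⟩),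
    (false, false, ⟨((0, 0), (0, 0)), 0⟩), (false, false, ⟨((3, 1), (8, 3)), 0⟩),
    (false, false, ⟨((5, -6), (13, -15)), 0⟩), (false, false, ⟨((-5, 6), (-13, 15)), 1⟩),
    (false, false, ⟨((-4, 3), (-11, 8)), 1⟩), (false, false, ⟨((-3, -1), (-8, -3)), 1⟩),
    (false, false, ⟨((-2, -4), (-6, -10)), 1⟩), (false, false, ⟨((1, 5), (2, 13)), 1⟩),
    (false, false, ⟨((3, -2), (7, -5)), 1⟩), (false, false, ⟨((6, -1), (15, -2)), 1⟩),
    (false, false, ⟨((-7, 2), (-19, 5)), 2⟩), (false, false, ⟨((-3, -1), (-8, -3)), 2⟩),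
    (false, false, ⟨((-2, 4), (-6, 10)), 2⟩), (false, false, ⟨((1, 5), (2, 13)), 2⟩),
    (false, false, ⟨((2, 1), (5, 2)), 2⟩), (false, false, ⟨((-7, 1), (-18, 1)), 3⟩),
    (false, false, ⟨((-5, 6), (-13, 15)), 3⟩), (false, false, ⟨((-3, 7), (-8, 17)), 3⟩),
    (false, false, ⟨((-2, -5), (-5, -14)), 3⟩), (false, false, ⟨((3, -3), (8, -9)), 3⟩),
    (false, false, ⟨((-5, 6), (-13, 15)), 4⟩), (false, false, ⟨((-4, 2), (-10, 4)), 4⟩),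
    (false, false, ⟨((-2, -5), (-5, -14)), 4⟩), (false, false, ⟨((-1, 3), (-2, 7)), 4⟩),
    (false, false, ⟨((1, -4), (3, -11)), 4⟩), (false, false, ⟨((-6, 1), (-15, 2)), 5⟩),
    (false, false, ⟨((-5, 6), (-13, 15)), 5⟩), (false, false, ⟨((-1, -5), (-2, -13)), 5⟩),
    (false, false, ⟨((-1, 3), (-2, 7)), 5⟩), (false, false, ⟨((1, -4), (3, -11)), 5⟩),
    (false, false, ⟨((4, -3), (11, -8)), 5⟩), (false, false, ⟨((6, -2), (16, -6)), 5⟩),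
    (false, true, ⟨((-4, 6), (-10, 16)), 0⟩), (false, true, ⟨((-2, -1), (-5, -2)), 0⟩),
    (false, true, ⟨((3, 1), (8, 3)), 0⟩), (false, true, ⟨((-4, 3), (-11, 8)), 1⟩),
    (false, true, ⟨((-2, -4), (-6, -10)), 1⟩), (false, true, ⟨((6, -1), (15, -2)), 1⟩),
    (false, true, ⟨((-7, 2), (-19, 5)), 2⟩), (false, true, ⟨((-6, 7), (-17, 18)), 2⟩),
    (false, true, ⟨((0, -3), (-1, -8)), 2⟩), (false, true, ⟨((5, -1), (12, -3)), 2⟩),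
    (false, true, ⟨((-6, 6), (-16, 14)), 3⟩), (false, true, ⟨((-3, 7), (-8, 17)), 3⟩),
    (false, true, ⟨((-5, 5), (-12, 11)), 4⟩), (false, true, ⟨((-3, -2), (-7, -7)), 4⟩),
    (false, true, ⟨((-2, -2), (-4, -6)), 5⟩), (false, true, ⟨((3, 0), (9, -1)), 5⟩),
    (true, false, ⟨((-3, -1), (-8, -3)), 0⟩), (true, false, ⟨((2, 1), (5, 2)), 0⟩),
    (true, false, ⟨((4, -6), (10, -16)), 0⟩), (true, false, ⟨((-2, 4), (-6, 10)), 1⟩),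
    (true, false, ⟨((0, -3), (-1, -8)), 1⟩), (true, false, ⟨((-5, 3), (-14, 7)), 2⟩),
    (true, false, ⟨((0, 5), (-1, 12)), 2⟩), (true, false, ⟨((-6, 6), (-16, 14)), 3⟩),
    (true, false, ⟨((-3, 7), (-8, 17)), 3⟩), (true, false, ⟨((-7, 1), (-18, 1)), 4⟩),
    (true, false, ⟨((-2, -5), (-5, -14)), 4⟩), (true, false, ⟨((1, 4), (3, 9)), 4⟩),
    (true, false, ⟨((3, -3), (8, -9)), 4⟩), (true, false, ⟨((-5, 6), (-13, 15)), 5⟩),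
    (true, false, ⟨((1, -4), (3, -11)), 5⟩), (true, false, ⟨((6, -2), (16, -6)), 5⟩),
    (true, true, ⟨((0, 0), (0, 0)), 0⟩)]

/-- The relative placement of a child of index `c` and a child of index `d` of two metatiles with
relative placement `g`. -/
def childRel (g : Place) (c d : Fin 7) : Place := (digit c)⁻¹ * inflatePlace g * digit d

/-- Twice the centre of a metatile. -/
def anchor : Phase := ((-1, 0), (-3, 0))

/-- Twice the displacement of the centres of two metatiles with relative placement `g`. -/
def center (g : Place) : Phase := g.pos + g.pos + rot g.dir anchor - anchor

/-- Twice the displacement of the centre of a child from the image of the centre of its parent. -/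
def childCenter (c : Fin 7) : Phase :=
  (digit c).pos + (digit c).pos + rot (digit c).dir anchor - inflate anchor

theorem center_childRel (g : Place) (c c' : Fin 7) :
    rot (digit c).dir (center (childRel g c c')) =
      inflate (center g) + rot g.dir (childCenter c') - childCenter c := by
  simp only [center, childCenter, childRel, Frame.mul_pos, Frame.mul_dir, Frame.inv_pos,
    Frame.inv_dir, inflatePlace, inflate_add, inflate_sub, inflate_rot, HexModule.rot_add,
    HexModule.rot_sub, HexModule.rot_neg, HexModule.rot_rot, add_neg_cancel,
    add_neg_cancel_left, HexModule.rot_zero]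
  abel_nf

/-- A sufficient criterion for two metatiles to be far apart. -/
def FarTest (v : Phase) : Prop :=
  ∃ j : ZMod 6, 2900000 + 38196 * (rot j v).1.1 ≤ 100000 * (rot j v).2.1 ∧
    2900000 + 38197 * (rot j v).1.1 ≤ 100000 * (rot j v).2.1

instance (v : Phase) : Decidable (FarTest v) := by unfold FarTest; infer_instance

theorem relations_childRel : ∀ s ∈ relations, ∀ c ∈ childIdx s.1, ∀ c' ∈ childIdx s.2.1,
    FarTest (center (childRel s.2.2 c c')) ∨
      (childKind c, childKind c', childRel s.2.2 c c') ∈ relations := by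
  decide +kernel

theorem relations_disjoint : ∀ s ∈ relations, s.2.2 = 1 ∧ s.1 = s.2.1 ∨
    ∀ y ∈ cells s.2.1, (proj s.2.2 * y).pos ∉ cellPos s.1 (proj s.2.2 * y).dir := by
  decide +kernel

theorem childCenter_bound : ∀ c, ∀ j : ZMod 6,
    |100000 * (rot j (childCenter c)).2.1 - 38196 * (rot j (childCenter c)).1.1| ≤ 2319000 ∧
    |100000 * (rot j (childCenter c)).2.1 - 38197 * (rot j (childCenter c)).1.1| ≤ 2319000 ∧
    |261803 * (rot j (childCenter c)).1.1 - 100000 * (rot j (childCenter c)).2.1| ≤ 168000 ∧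
    |261804 * (rot j (childCenter c)).1.1 - 100000 * (rot j (childCenter c)).2.1| ≤ 168000 := by
  decide +kernel

theorem cell_center_bound : ∀ x ∈ cells false, ∀ j : ZMod 6,
    (rot j (x.pos + x.pos - anchor.1)).1 ≤ 5 := by
  decide +kernel

end Hat

namespace Hat

/-- The contraction factor of the substitution. -/
noncomputable def contraction : ℝ := (3 - √5) / 2

theorem contraction_mul_self : contraction * contraction = 3 * contraction - 1 := by
  have := Real.mul_self_sqrt (show (0 : ℝ) ≤ 5 by norm_num)
  rw [contraction]; linarith

theorem lt_contraction : 0.38196 < contraction := by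
  have : √5 < 2.23608 := by rw [Real.sqrt_lt' (by norm_num)]; norm_num
  rw [contraction]; linarith

theorem contraction_lt : contraction < 0.38197 := by
  have : 2.23606 < √5 := by rw [Real.lt_sqrt (by norm_num)]; norm_num
  rw [contraction]; linarith

/-- A linear form expanded by the substitution. -/
noncomputable def expandingForm : Phase →+ ℝ :=
  AddMonoidHom.mk' (fun v => v.2.1 - contraction * v.1.1) fun v w => by
    simp only [Prod.fst_add, Prod.snd_add, Int.cast_add]; ring

theorem expandingForm_apply (v : Phase) : expandingForm v = v.2.1 - contraction * v.1.1 := rfl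

/-- A linear form contracted by the substitution. -/
noncomputable def contractingForm : Phase →+ ℝ :=
  AddMonoidHom.mk' (fun v => (3 - contraction) * v.1.1 - v.2.1) fun v w => by
    simp only [Prod.fst_add, Prod.snd_add, Int.cast_add]; ring

theorem contractingForm_apply (v : Phase) :
    contractingForm v = (3 - contraction) * v.1.1 - v.2.1 := rfl

theorem expandingForm_inflate (v : Phase) :
    expandingForm (inflate v) = (3 - contraction) * expandingForm v := by
  simp only [expandingForm_apply, inflate, Int.cast_sub, Int.cast_mul, Int.cast_ofNat]
  linear_combination (-v.1.1 : ℝ) * contraction_mul_self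

theorem contractingForm_inflate (v : Phase) :
    contractingForm (inflate v) = contraction * contractingForm v := by
  simp only [contractingForm_apply, inflate, Int.cast_sub, Int.cast_mul, Int.cast_ofNat]
  linear_combination (v.1.1 : ℝ) * contraction_mul_self

theorem contraction_mul_le (x : ℝ) :
    contraction * x ≤ 0.38196 * x ∨ contraction * x ≤ 0.38197 * x := by
  rcases le_total 0 x with h | h
  · exact Or.inr (mul_le_mul_of_nonneg_right contraction_lt.le h)
  · exact Or.inl (mul_le_mul_of_nonpos_right lt_contraction.le h)

theorem le_contraction_mul (x : ℝ) :
    0.38196 * x ≤ contraction * x ∨ 0.38197 * x ≤ contraction * x := by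
  rcases le_total 0 x with h | h
  · exact Or.inl (mul_le_mul_of_nonneg_right lt_contraction.le h)
  · exact Or.inr (mul_le_mul_of_nonpos_right contraction_lt.le h)

theorem abs_expandingForm_childCenter (c : Fin 7) (j : ZMod 6) :
    |expandingForm (rot j (childCenter c))| ≤ 23.19 := by
  obtain ⟨h1, h2, -⟩ := childCenter_bound c j
  rw [expandingForm_apply]
  generalize rot j (childCenter c) = v at *
  rw [abs_le] at *
  have h1a : ((-2319000 : ℤ) : ℝ) ≤ _ := Int.cast_le.2 h1.1
  have h1b : _ ≤ ((2319000 : ℤ) : ℝ) := Int.cast_le.2 h1.2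
  have h2a : ((-2319000 : ℤ) : ℝ) ≤ _ := Int.cast_le.2 h2.1
  have h2b : _ ≤ ((2319000 : ℤ) : ℝ) := Int.cast_le.2 h2.2
  push_cast at h1a h1b h2a h2b
  constructor
  · rcases contraction_mul_le v.1.1 with h | h <;> linarith
  · rcases le_contraction_mul v.1.1 with h | h <;> linarith

theorem abs_contractingForm_childCenter (c : Fin 7) (j : ZMod 6) :
    |contractingForm (rot j (childCenter c))| ≤ 1.68 := by
  obtain ⟨-, -, h1, h2⟩ := childCenter_bound c j
  rw [contractingForm_apply]
  generalize rot j (childCenter c) = v at *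
  rw [abs_le] at *
  have h1a : ((-168000 : ℤ) : ℝ) ≤ _ := Int.cast_le.2 h1.1
  have h1b : _ ≤ ((168000 : ℤ) : ℝ) := Int.cast_le.2 h1.2
  have h2a : ((-168000 : ℤ) : ℝ) ≤ _ := Int.cast_le.2 h2.1
  have h2b : _ ≤ ((168000 : ℤ) : ℝ) := Int.cast_le.2 h2.2
  push_cast at h1a h1b h2a h2b
  constructor
  · rcases contraction_mul_le v.1.1 with h | h <;> linarith
  · rcases le_contraction_mul v.1.1 with h | h <;> linarith

/-- A lower bound on the distance to the origin. -/
def Far (v : Phase) : Prop := ∃ j : ZMod 6, 29 ≤ expandingForm (rot j v)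

/-- An upper bound on the conjugate distance to the origin. -/
def Near (v : Phase) : Prop := ∀ j : ZMod 6, contractingForm (rot j v) ≤ 5.5

theorem FarTest.far {v : Phase} (h : FarTest v) : Far v := by
  obtain ⟨j, h1, h2⟩ := h
  refine ⟨j, ?_⟩
  rw [expandingForm_apply]
  generalize rot j v = v at *
  have h1 : ((2900000 + 38196 * v.1.1 : ℤ) : ℝ) ≤ (100000 * v.2.1 : ℤ) := Int.cast_le.2 h1
  have h2 : ((2900000 + 38197 * v.1.1 : ℤ) : ℝ) ≤ (100000 * v.2.1 : ℤ) := Int.cast_le.2 h2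
  push_cast at h1 h2
  rcases contraction_mul_le v.1.1 with h | h <;> linarith

theorem rot_center_childRel (g : Place) (c c' : Fin 7) (j : ZMod 6) :
    rot (j + (digit c).dir) (center (childRel g c c')) =
      inflate (rot j (center g)) + rot (j + g.dir) (childCenter c') - rot j (childCenter c) := by
  rw [← HexModule.rot_rot, center_childRel, HexModule.rot_sub, HexModule.rot_add, inflate_rot,
    HexModule.rot_rot]

theorem Far.childRel {g : Place} (h : Far (center g)) (c c' : Fin 7) :
    Far (center (childRel g c c')) := by
  obtain ⟨j, hj⟩ := h
  refine ⟨j + (digit c).dir, ?_⟩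
  rw [rot_center_childRel, map_sub, map_add, expandingForm_inflate]
  have h1 := abs_le.1 (abs_expandingForm_childCenter c' (j + g.dir))
  have h2 := abs_le.1 (abs_expandingForm_childCenter c j)
  nlinarith [contraction_lt, h1.1, h2.2]

theorem Near.childRel {g : Place} (h : Near (center g)) (c c' : Fin 7) :
    Near (center (childRel g c c')) := by
  intro j
  have hj := h (j - (digit c).dir)
  have key := rot_center_childRel g c c' (j - (digit c).dir)
  rw [sub_add_cancel] at key
  rw [key, map_sub, map_add, contractingForm_inflate]
  have h1 := abs_le.1 (abs_contractingForm_childCenter c' (j - (digit c).dir + g.dir))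
  have h2 := abs_le.1 (abs_contractingForm_childCenter c (j - (digit c).dir))
  nlinarith [contraction_lt, lt_contraction, h1.2, h2.1]

theorem child_inv_mul_child (σ σ' : Meta) (c c' : Fin 7) :
    (child σ c).2⁻¹ * (child σ' c').2 = childRel (σ.2⁻¹ * σ'.2) c c' := by
  simp only [child, childRel, inflatePlace_mul, inflatePlace_inv, mul_inv_rev, inv_inv, mul_assoc,
    mul_inv_cancel_left]

theorem patch_pair (n : ℕ) : ∀ τ ∈ patch n, ∀ τ' ∈ patch n,
    ((τ.1, τ'.1, τ.2⁻¹ * τ'.2) ∈ relations ∨ Far (center (τ.2⁻¹ * τ'.2))) ∧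
      Near (center (τ.2⁻¹ * τ'.2)) := by
  induction n with
  | zero =>
    simp only [patch, List.mem_singleton]
    rintro _ rfl _ rfl
    refine ⟨Or.inl (by decide +kernel), fun j => ?_⟩
    rw [show center (1⁻¹ * 1) = 0 from rfl, HexModule.rot_of_zero, map_zero]
    norm_num
  | succ n ih =>
    intro τ hτ τ' hτ'
    obtain ⟨σ, hσ, c, hc, rfl⟩ := mem_patch_succ.1 hτ
    obtain ⟨σ', hσ', c', hc', rfl⟩ := mem_patch_succ.1 hτ'
    obtain ⟨h1, h2⟩ := ih σ hσ σ' hσ'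
    rw [child_inv_mul_child]
    refine ⟨?_, h2.childRel c c'⟩
    rcases h1 with h1 | h1
    · exact (relations_childRel _ h1 c hc c' hc').symm.imp_right FarTest.far
    · exact Or.inr (h1.childRel c c')

theorem hats_subset (i : Bool) : ∀ q ∈ hats i, q ∈ hats false := by
  revert i; decide +kernel

theorem cells_subset (i : Bool) : ∀ x ∈ cells i, x ∈ cells false := by
  intro x hx
  obtain ⟨q, hq, hx⟩ := mem_cells.1 hx
  exact mem_cells.2 ⟨q, hats_subset i q hq, hx⟩

theorem hats_disjoint : ∀ q ∈ hats false, ∀ q' ∈ hats false, ∀ l l',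
    q.1 * tile q.2 l = q'.1 * tile q'.2 l' → q = q' ∧ l = l' := by
  decide +kernel

theorem rot_add_three_fst (j : ZMod 6) (v : ℤ × ℤ) : (rot (j + 3) v).1 = -(rot j v).1 := by
  rw [add_comm, ← HexModule.rot_rot]; rfl

theorem Far.not_overlap {g : Place} (h : Far (center g)) (h' : Near (center g)) {x y : Kite}
    (hx : x ∈ cells false) (hy : y ∈ cells false) (hxy : x = proj g * y) : False := by
  obtain ⟨j, hj⟩ := h
  have h1 := cell_center_bound x hx j
  have h2 := cell_center_bound y hy (j + g.dir + 3)
  have h3 := h' (j + 3)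
  have h4 : (center g).1 = (x.pos + x.pos - anchor.1) - rot g.dir (y.pos + y.pos - anchor.1) := by
    rw [hxy, HexModule.rot_sub, HexModule.rot_add]
    simp only [center, Frame.mul_pos, proj, Prod.fst_add, Prod.fst_sub, rot_phase,
      MonoidHom.coe_mk, OneHom.coe_mk]
    abel
  rw [rot_add_three_fst, ← HexModule.rot_rot] at h2
  have h5 : (rot j (center g).1).1 ≤ 10 := by
    rw [h4, HexModule.rot_sub, Prod.fst_sub]; linarith
  have h6 : rot (j + 3) (center g) = -rot j (center g) := by
    rw [add_comm, ← HexModule.rot_rot]; rfl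
  rw [h6, map_neg, contractingForm_apply] at h3
  rw [expandingForm_apply] at hj
  have h7 : ((rot j (center g)).1.1 : ℝ) ≤ 10 := by exact_mod_cast h5
  nlinarith [lt_contraction, contraction_lt]

theorem patch_disjoint {n : ℕ} {τ τ' : Meta} (hτ : τ ∈ patch n) (hτ' : τ' ∈ patch n) {x y : Kite}
    (hx : x ∈ cells τ.1) (hy : y ∈ cells τ'.1) (h : proj τ.2 * x = proj τ'.2 * y) : τ = τ' := by
  have hxy : x = proj (τ.2⁻¹ * τ'.2) * y := by
    rw [map_mul, map_inv, mul_assoc, ← h, inv_mul_cancel_left]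
  obtain ⟨h1 | h1, h2⟩ := patch_pair n τ hτ τ' hτ'
  · rcases relations_disjoint _ h1 with ⟨h3, h4⟩ | h3
    · exact Prod.ext h4 (inv_mul_eq_one.1 h3)
    · refine absurd (pos_mem_cellPos _ x hx) ?_
      have := h3 y hy
      rwa [← hxy] at this
  · exact (h1.not_overlap h2 (cells_subset _ x hx) (cells_subset _ y hy) hxy).elim

theorem exists_corona (n : ℕ) : ∀ τ ∈ patch n, ∃ Z ∈ coronas, Z.1 = τ.1 ∧
    ∀ z ∈ (Z.1, 1) :: Z.2, (z.1, τ.2 * z.2) ∈ patch (n + 3) := by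
  induction n with
  | zero =>
    simp only [patch, List.mem_singleton]
    rintro _ rfl
    obtain ⟨Z, hZ, h1, h2⟩ := corona_patch
    refine ⟨Z, hZ, h1, fun z hz => ?_⟩
    rw [one_mul]
    rcases List.mem_cons.1 hz with rfl | hz
    · rw [h1]; exact patch_subset (Nat.zero_le 3) _ (List.mem_singleton.2 rfl)
    · exact h2 z hz
  | succ n ih =>
    intro τ hτ
    obtain ⟨σ, hσ, c, hc, rfl⟩ := mem_patch_succ.1 hτ
    obtain ⟨Z, hZ, h1, h2⟩ := ih σ hσ
    rw [← h1] at hc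
    obtain ⟨Z', hZ', h3, h4⟩ := corona_child Z hZ c hc
    refine ⟨Z', hZ', h3, fun z' hz' => ?_⟩
    rcases List.mem_cons.1 hz' with rfl | hz'
    · rw [mul_one, h3]
      exact patch_subset (by omega) _ hτ
    · obtain ⟨z, hz, c', hc', h5, h6⟩ := h4 z' hz'
      refine mem_patch_succ.2 ⟨_, h2 z hz, c', hc', Prod.ext h5 ?_⟩
      simp only [child, ← h6, inflatePlace_mul, mul_assoc, mul_inv_cancel_left]

theorem closure_r6_r3 : Subgroup.closure {r6, r3} = (⊤ : Subgroup Kite) := by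
  refine Subgroup.map_injective el_injective ?_
  rw [MonoidHom.map_closure, Set.image_pair, ← MonoidHom.range_eq_map, range_el]
  rw [show el r6 = R6 from el_R6, show el r3 = R3 from el_R3]
  rfl

theorem exists_mem_patch (g : Kite) : ∃ n, ∃ τ ∈ patch n, ∃ x ∈ cells τ.1, proj τ.2 * x = g := by
  have hmul : ∀ s ∈ [r6, r3], ∀ g : Kite,
      (∃ n, ∃ τ ∈ patch n, ∃ x ∈ cells τ.1, proj τ.2 * x = g) →
        ∃ n, ∃ τ ∈ patch n, ∃ x ∈ cells τ.1, proj τ.2 * x = g * s := by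
    rintro s hs _ ⟨n, τ, hτ, x, hx, rfl⟩
    obtain ⟨Z, hZ, h1, h2⟩ := exists_corona n τ hτ
    rw [← h1] at hx
    obtain ⟨z, hz, h3⟩ := corona_cells Z hZ s hs x hx
    refine ⟨n + 3, _, h2 z hz, _, mem_cells_of_mem_cellPos _ _ _ h3, ?_⟩
    simp only [map_mul]
    change proj τ.2 * proj z.2 * ((proj z.2)⁻¹ * (x * s)) = _
    simp only [mul_assoc, mul_inv_cancel_left]
  have hmem : g ∈ Subgroup.closure {r6, r3} := by rw [closure_r6_r3]; exact Subgroup.mem_top g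
  induction hmem using Subgroup.closure_induction_right with
  | one =>
    refine ⟨0, _, List.mem_singleton.2 rfl, 1, ?_, rfl⟩
    decide +kernel
  | mul_right x _ y hy ih =>
    rcases hy with rfl | rfl
    · exact hmul _ (by simp) _ ih
    · exact hmul _ (by simp) _ ih
  | mul_inv_cancel x _ y hy ih =>
    rcases hy with rfl | rfl
    · rw [show r6⁻¹ = r6 * r6 * r6 * r6 * r6 by decide +kernel]
      simp only [← mul_assoc]
      iterate 5 refine hmul _ (by simp) _ ?_
      exact ih
    · rw [show r3⁻¹ = r3 * r3 by decide +kernel, ← mul_assoc]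
      iterate 2 refine hmul _ (by simp) _ ?_
      exact ih

theorem isTiling_hatPlacements : IsTiling hatPlacements := by
  intro g
  obtain ⟨n, τ, hτ, x, hx, rfl⟩ := exists_mem_patch g
  obtain ⟨q, hq, l, rfl⟩ := mem_cells.1 hx
  refine ⟨((proj τ.2 * q.1, q.2), l), ⟨⟨n, τ, hτ, q, hq, rfl⟩, mul_assoc _ _ _⟩, ?_⟩
  rintro ⟨_, l'⟩ ⟨⟨n', τ', hτ', q', hq', rfl⟩, h⟩
  rw [mul_assoc] at h
  obtain rfl := patch_disjoint (patch_subset (le_max_left n n') _ hτ)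
    (patch_subset (le_max_right n n') _ hτ') (mem_cells.2 ⟨q, hq, l, rfl⟩)
    (mem_cells.2 ⟨q', hq', l', rfl⟩) h.symm
  obtain ⟨rfl, rfl⟩ := hats_disjoint q (hats_subset _ q hq) q' (hats_subset _ q' hq') l l'
    (mul_left_cancel h.symm)
  rfl

end Hat

theorem statement_6 :
    -- `S'` is also a subset of `Γ⁺`:
    hatPlusRefl ⊆ (Γplus : Set KitegridGroup) ∧
    -- the tileset `{S, S'}` tiles `Γ⁺`,
    (∃ C, IsCotiler2 C) ∧
    -- every cotiler has finite stabilizer (in `Γ⁺`),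
    (∀ C, IsCotiler2 C →
      {h : KitegridGroup | h ∈ Γplus ∧
        (fun p : KitegridGroup × Set KitegridGroup => (h * p.1, p.2)) '' C = C}.Finite) ∧
    -- and `S`, `S'` are not left translates of each other in `Γ⁺`:
    ¬ ∃ c ∈ Γplus, c • hatPlus = hatPlusRefl := by
  exact ⟨Hat.hatPlusRefl_subset, ⟨_, Hat.isCotiler2_of_isTiling Hat.isTiling_hatPlacements⟩,
    fun C hC => Hat.finite_stabilizer (Hat.isTiling_of_isCotiler2 hC).finite_symmetries,
    Hat.smul_hatPlus_ne⟩
end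

section
/- In the cell decomposition setting, every tile T ∈ 𝒯 is poly-𝒦: there is a finite set grp_𝒦(T) ⊆ G×𝒦 such that T = ⊔_{(g,K) ∈ grp_𝒦(T)} g·K up to a λ-null set. Moreover, whenever g·K intersects T in a set of positive measure for some (g,K) ∈ G×𝒦, then g·K ⊆ T up to a λ-null set. -/
open scoped Pointwise
open MeasureTheory

/-- `χ(x)`: the set of pairs `(g,T)` with `T ∈ 𝒯` such that `g • T` covers `x`. -/
def chiFn {W : Type*} (G : Type*) [Group G] [MulAction G W]
    (𝒯 : Set (Set W)) (x : W) : Set (G × Set W) :=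
  {p : G × Set W | p.2 ∈ 𝒯 ∧ x ∈ p.1 • p.2}

/-- The cell `K_x = {y ∈ F : χ(y) = χ(x)}` of a point `x`. -/
def cellOf {W : Type*} (G : Type*) [Group G] [MulAction G W]
    (𝒯 : Set (Set W)) (F : Set W) (x : W) : Set W :=
  {y ∈ F | chiFn G 𝒯 y = chiFn G 𝒯 x}

/-- The set `𝒦` of positive-measure cells. -/
def cells {W : Type*} [MeasurableSpace W] (G : Type*) [Group G] [MulAction G W]
    (μ : Measure W) (𝒯 : Set (Set W)) (F : Set W) : Set (Set W) :=
  {S : Set W | ∃ x ∈ F, S = cellOf G 𝒯 F x ∧ 0 < μ S}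

section CellDecomposition

variable {W G : Type*} [Group G] [MulAction G W] {𝒯 : Set (Set W)} {F : Set W}

theorem mem_cellOf_self {x : W} (hx : x ∈ F) : x ∈ cellOf G 𝒯 F x := ⟨hx, rfl⟩

theorem cellOf_eq_of_mem {x y : W} (hy : y ∈ cellOf G 𝒯 F x) :
    cellOf G 𝒯 F y = cellOf G 𝒯 F x := by
  ext z
  simp only [cellOf, Set.mem_ofPred_eq, hy.2]

theorem smul_cellOf_subset {T : Set W} (hT : T ∈ 𝒯) {g : G} {x y : W}
    (hy : y ∈ cellOf G 𝒯 F x) (hgy : g • y ∈ T) : g • cellOf G 𝒯 F x ⊆ T := by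
  rintro _ ⟨z, hz, rfl⟩
  have hmem : (g⁻¹, T) ∈ chiFn G 𝒯 y := ⟨hT, by simpa [Set.mem_inv_smul_set_iff] using hgy⟩
  rw [hy.2, ← hz.2] at hmem
  simpa [Set.mem_inv_smul_set_iff] using hmem.2

theorem smul_subset_of_mem_cells [MeasurableSpace W] {μ : Measure W} {T K : Set W} (hT : T ∈ 𝒯)
    {g : G} (hK : K ∈ cells G μ 𝒯 F) (hne : (g • K ∩ T).Nonempty) : g • K ⊆ T := by
  obtain ⟨x, -, rfl, -⟩ := hK
  obtain ⟨_, ⟨y, hy, rfl⟩, hyT⟩ := hne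
  exact smul_cellOf_subset hT hy hyT

theorem subset_of_mem_cells [MeasurableSpace W] {μ : Measure W} {K : Set W}
    (hK : K ∈ cells G μ 𝒯 F) : K ⊆ F := by
  obtain ⟨x, -, rfl, -⟩ := hK
  exact fun y hy => hy.1

theorem disjoint_of_mem_cells [MeasurableSpace W] {μ : Measure W} {K L : Set W}
    (hK : K ∈ cells G μ 𝒯 F) (hL : L ∈ cells G μ 𝒯 F) (hne : K ≠ L) : Disjoint K L := by
  obtain ⟨x, -, rfl, -⟩ := hK
  obtain ⟨y, -, rfl, -⟩ := hL
  exact Set.disjoint_left.2 fun z hzx hzy =>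
    hne ((cellOf_eq_of_mem hzx).symm.trans (cellOf_eq_of_mem hzy))

theorem finite_setOf_measure_smul_inter_pos [TopologicalSpace W] [MeasurableSpace W]
    {μ : Measure W}
    (hlpd : ∀ Q : Set W, IsCompact Q → {g : G | 0 < μ ((g • Q) ∩ Q)}.Finite)
    {A B : Set W} (hA : IsCompact (closure A)) (hB : IsCompact (closure B)) :
    {g : G | 0 < μ ((g • A) ∩ B)}.Finite := by
  refine (hlpd _ (hA.union hB)).subset fun g hg => lt_of_lt_of_le hg (measure_mono ?_)
  exact Set.inter_subset_inter
    (Set.smul_set_mono (subset_closure.trans Set.subset_union_left))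
    (subset_closure.trans Set.subset_union_right)

/-- Outside a null set, only finitely many tile translates meet the fundamental domain. -/
theorem exists_finite_chiFn_subset [TopologicalSpace W] [MeasurableSpace W] [Countable G]
    {μ : Measure W}
    (hlpd : ∀ Q : Set W, IsCompact Q → {g : G | 0 < μ ((g • Q) ∩ Q)}.Finite)
    (h𝒯fin : 𝒯.Finite) (h𝒯 : ∀ T ∈ 𝒯, IsCompact (closure T)) (hF : IsCompact (closure F)) :
    ∃ A : Set (G × Set W), A.Finite ∧ μ {x ∈ F | ¬ chiFn G 𝒯 x ⊆ A} = 0 := by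
  refine ⟨⋃ T ∈ 𝒯, (fun g : G => (g, T)) '' {g : G | 0 < μ ((g • T) ∩ F)},
    h𝒯fin.biUnion fun T hT =>
      (finite_setOf_measure_smul_inter_pos hlpd (h𝒯 T hT) hF).image _, ?_⟩
  have hnull : μ (⋃ T ∈ 𝒯, ⋃ g ∈ {g : G | μ ((g • T) ∩ F) = 0}, (g • T) ∩ F) = 0 :=
    (measure_biUnion_null_iff h𝒯fin.countable).2 fun T _ =>
      (measure_biUnion_null_iff (Set.to_countable _)).2 fun g hg => hg
  refine measure_mono_null ?_ hnull
  rintro x ⟨hxF, hx⟩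
  obtain ⟨⟨g, T⟩, ⟨hT, hgx⟩, hgT⟩ := Set.not_subset.1 hx
  refine Set.mem_biUnion hT (Set.mem_biUnion (x := g) ?_ ⟨hgx, hxF⟩)
  by_contra h
  exact hgT (Set.mem_biUnion hT ⟨g, pos_iff_ne_zero.2 h, rfl⟩)

theorem finite_cells [MeasurableSpace W] {μ : Measure W} {A : Set (G × Set W)} (hA : A.Finite)
    (hnull : μ {x ∈ F | ¬ chiFn G 𝒯 x ⊆ A} = 0) : (cells G μ 𝒯 F).Finite := by
  refine (hA.finite_subsets.image fun S => {y ∈ F | chiFn G 𝒯 y = S}).subset ?_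
  rintro _ ⟨x, -, rfl, hpos⟩
  refine ⟨chiFn G 𝒯 x, ?_, rfl⟩
  by_contra hx
  refine hpos.ne' (measure_mono_null ?_ hnull)
  exact fun y hy => ⟨hy.1, by rw [hy.2]; exact hx⟩

theorem measure_setOf_null_cellOf [MeasurableSpace W] {μ : Measure W} {A : Set (G × Set W)}
    (hA : A.Finite) (hnull : μ {x ∈ F | ¬ chiFn G 𝒯 x ⊆ A} = 0) :
    μ {x ∈ F | μ (cellOf G 𝒯 F x) = 0} = 0 := by
  have hfib : μ (⋃ S ∈ {S | S ⊆ A ∧ μ {y ∈ F | chiFn G 𝒯 y = S} = 0},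
      {y ∈ F | chiFn G 𝒯 y = S}) = 0 :=
    (measure_biUnion_null_iff
      (hA.finite_subsets.subset fun _ hS => hS.1).countable).2 fun S hS => hS.2
  refine measure_mono_null ?_ (measure_union_null hnull hfib)
  rintro x ⟨hxF, hx⟩
  by_cases h : chiFn G 𝒯 x ⊆ A
  · exact Or.inr (Set.mem_biUnion (x := chiFn G 𝒯 x) ⟨h, hx⟩ ⟨hxF, rfl⟩)
  · exact Or.inl ⟨hxF, h⟩

theorem measure_smul_eq_zero_of_pos [MeasurableSpace W] {μ : Measure W}
    (hneg : ∀ (g : G) (A : Set W), 0 < μ A → 0 < μ (g • A)) (g : G) {A : Set W}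
    (hA : μ A = 0) : μ (g • A) = 0 := by
  by_contra h
  have := hneg g⁻¹ _ (pos_iff_ne_zero.2 h)
  rw [inv_smul_smul, hA] at this
  exact this.false

end CellDecomposition

theorem statement_13 {W : Type*} [TopologicalSpace W] [MeasurableSpace W] [BorelSpace W]
    {G : Type*} [Group G] [Countable G] [MulAction G W]
    (hcont : ∀ g : G, Continuous fun x : W => g • x)
    (μ : Measure W) (hμ : μ ≠ 0)
    (hneg : ∀ (g : G) (A : Set W), 0 < μ A → 0 < μ (g • A))
    -- the action is cocompact:
    (hcc : ∃ Q : Set W, IsCompact Q ∧ (⋃ g : G, g • Q) = Set.univ)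
    -- the action is `λ`-properly discontinuous:
    (hlpd : ∀ Q : Set W, IsCompact Q → {g : G | 0 < μ ((g • Q) ∩ Q)}.Finite)
    -- `𝒯` is a finite set of relatively compact tiles:
    (𝒯 : Set (Set W)) (h𝒯fin : 𝒯.Finite)
    (h𝒯 : ∀ T ∈ 𝒯, MeasurableSet T ∧ 0 < μ T ∧ IsCompact (closure T))
    -- `F` is a relatively compact fundamental domain up to `μ`-null sets:
    (F : Set W) (hFrc : IsCompact (closure F))
    (hFdisj : ∀ g h : G, g ≠ h → μ ((g • F) ∩ (h • F)) = 0)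
    (hFcover : μ ((⋃ g : G, g • F)ᶜ) = 0) :
    -- every `T ∈ 𝒯` is poly-`𝒦` for `𝒦 = cells`:
    (∀ T ∈ 𝒯, ∃ D : Set (G × Set W), D.Finite ∧
      (∀ p ∈ D, p.2 ∈ cells G μ 𝒯 F) ∧
      (∀ p ∈ D, ∀ q ∈ D, p ≠ q → μ (p.1 • p.2 ∩ q.1 • q.2) = 0) ∧
      μ (symmDiff T (⋃ p ∈ D, p.1 • p.2)) = 0) ∧
    -- moreover any cell translate meeting `T` in positive measure is a.e. contained in `T`:
    (∀ T ∈ 𝒯, ∀ (g : G), ∀ K ∈ cells G μ 𝒯 F,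
      0 < μ ((g • K) ∩ T) → μ ((g • K) \ T) = 0) := by
  obtain ⟨A, hAfin, hAnull⟩ :=
    exists_finite_chiFn_subset (G := G) hlpd h𝒯fin (fun T hT => (h𝒯 T hT).2.2) hFrc
  refine ⟨fun T hT => ?_, fun T hT g K hK hpos => ?_⟩
  · refine ⟨{p | p.2 ∈ cells G μ 𝒯 F ∧ 0 < μ ((p.1 • p.2) ∩ T)}, ?_, fun p hp => hp.1, ?_, ?_⟩
    · refine ((finite_setOf_measure_smul_inter_pos hlpd hFrc (h𝒯 T hT).2.2).prod
        (finite_cells hAfin hAnull)).subset fun p hp => ⟨?_, hp.1⟩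
      exact lt_of_lt_of_le hp.2 (measure_mono (Set.inter_subset_inter_left _
        (Set.smul_set_mono (subset_of_mem_cells hp.1))))
    · rintro ⟨g, K⟩ ⟨hK, -⟩ ⟨h, L⟩ ⟨hL, -⟩ hne
      by_cases hgh : g = h
      · subst hgh
        have hKL : K ≠ L := fun e => hne (by rw [e])
        rw [← Set.smul_set_inter, (disjoint_of_mem_cells hK hL hKL).inter_eq]
        simp
      · exact measure_mono_null (Set.inter_subset_inter
          (Set.smul_set_mono (subset_of_mem_cells hK))
          (Set.smul_set_mono (subset_of_mem_cells hL))) (hFdisj g h hgh)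
    · have hnull : μ (⋃ g : G, g • {x ∈ F | μ (cellOf G 𝒯 F x) = 0}) = 0 :=
        measure_iUnion_null fun g =>
          measure_smul_eq_zero_of_pos hneg g (measure_setOf_null_cellOf hAfin hAnull)
      refine measure_mono_null ?_ (measure_union_null hFcover hnull)
      rintro t (⟨htT, htD⟩ | ⟨htD, htT⟩)
      · by_cases htF : t ∈ ⋃ g : G, g • F
        · obtain ⟨g, x, hxF, rfl⟩ := Set.mem_iUnion.1 htF
          refine Or.inr (Set.mem_iUnion.2 ⟨g, x, ⟨hxF, ?_⟩, rfl⟩)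
          by_contra hx
          have hpos : 0 < μ (cellOf G 𝒯 F x) := pos_iff_ne_zero.2 hx
          have hsub : g • cellOf G 𝒯 F x ⊆ T := smul_cellOf_subset hT (mem_cellOf_self hxF) htT
          refine htD (Set.mem_biUnion (x := (g, cellOf G 𝒯 F x)) ⟨⟨x, hxF, rfl, hpos⟩, ?_⟩
            ⟨x, mem_cellOf_self hxF, rfl⟩)
          rw [Set.inter_eq_left.2 hsub]
          exact hneg g _ hpos
        · exact Or.inl htF
      · obtain ⟨p, hp, htp⟩ := Set.mem_iUnion₂.1 htD
        exact absurd (smul_subset_of_mem_cells hT hp.1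
          (nonempty_of_measure_ne_zero hp.2.ne') htp) htT
  · rw [Set.sdiff_eq_empty.2
      (smul_subset_of_mem_cells hT hK (nonempty_of_measure_ne_zero hpos.ne')), measure_empty]
end
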